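/- arXiv:1411.3142 — 8 statements merged into one kernel-verified Lean document; each statement's English description precedes it below -/
import Mathlib

section
/- Let σ be a permutation of {1,…,N} with σ ≠ id, let y ∈ W_N^+, let ε > 0, and let f : ℝ^N → ℝ be smooth with compact support contained in W_{N,ε}^+. Then lim_{t→0+} ∫_{ℝ^N} f(x) I_σ(y;x,t) dx = 0. -/
open MeasureTheory Filter Set

/-- The point on the vertical contour `Γ_a` at height `φ`. -/
noncomputable def lineZ (a φ : ℝ) : ℂ := (a : ℂ) + φ * Complex.I

/-- The ratio of scattering amplitudes `S(z_α, z_β) = −(τ z_α − z_β)/(τ z_β − z_α)`. -/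
noncomputable def Sfac (τ : ℝ) (zα zβ : ℂ) : ℂ := -(((τ : ℂ) * zα - zβ) / ((τ : ℂ) * zβ - zα))

/-- The Bethe-ansatz amplitude `A_σ(z) = ∏_{(α,β) ∈ In(σ)} S(z_α, z_β)`, the product being
over the inversions of `σ`, i.e. over pairs `(σ(i), σ(j))` with `i < j` and `σ(i) > σ(j)`. -/
noncomputable def Aamp (N : ℕ) (τ : ℝ) (σ : Equiv.Perm (Fin N)) (z : Fin N → ℂ) : ℂ :=
  ∏ pr ∈ Finset.univ.filter (fun pr : Fin N × Fin N => pr.1 < pr.2 ∧ σ pr.2 < σ pr.1),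
    Sfac τ (z (σ pr.1)) (z (σ pr.2))

/-- The single-permutation contour integral
`I_σ(y;x,t) = ∫_{Γ_a} dz₁ ⋯ ∫_{Γ_a} dz_N A_σ(z) ∏_j e^{z_{σ(j)}(x_j − y_{σ(j)})} e^{z_j² t/2}`,
each contour integral carrying the conventional prefactor `1/(2πi)`. -/
noncomputable def Iperm (N : ℕ) (τ a : ℝ) (σ : Equiv.Perm (Fin N))
    (y x : Fin N → ℝ) (t : ℝ) : ℂ :=
  (1 / (2 * Real.pi)) ^ N *
    ∫ φ : Fin N → ℝ,
      Aamp N τ σ (fun j => lineZ a (φ j)) *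
        ∏ j : Fin N,
          Complex.exp (lineZ a (φ (σ j)) * ((x j : ℂ) - (y (σ j) : ℂ))) *
            Complex.exp (lineZ a (φ j) ^ 2 * (t : ℂ) / 2)

/-- The Bethe-ansatz function `Q_y(x,t) = Σ_{σ ∈ S_N} I_σ(y;x,t)`. -/
noncomputable def Qfun (N : ℕ) (τ a : ℝ) (y x : Fin N → ℝ) (t : ℝ) : ℂ :=
  ∑ σ : Equiv.Perm (Fin N), Iperm N τ a σ y x t

/-- The Weyl chamber `W_N^+ = {y ∈ ℝ^N : y₁ ≤ ⋯ ≤ y_N}`. -/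
def WeylPlus (N : ℕ) : Set (Fin N → ℝ) := {y | Monotone y}

/-- `W_{N,ε}^+ = {x ∈ W_N^+ : x_{j+1} − x_j ≥ ε for all j}`. -/
def WeylPlusEps (N : ℕ) (ε : ℝ) : Set (Fin N → ℝ) :=
  {x | Monotone x ∧ ∀ (j : Fin N) (hj : (j : ℕ) + 1 < N), ε ≤ x ⟨(j : ℕ) + 1, hj⟩ - x j}

@[simp] lemma lineZ_re (a φ : ℝ) : (lineZ a φ).re = a := by simp [lineZ]

@[simp] lemma lineZ_im (a φ : ℝ) : (lineZ a φ).im = φ := by simp [lineZ]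

@[fun_prop] lemma continuous_lineZ (a : ℝ) : Continuous (lineZ a) := by
  unfold lineZ
  fun_prop

/-- A function that is holomorphic on a vertical strip and has Gaussian decay there has the same
integral over the two boundary lines of the strip. -/
lemma integral_lineZ_eq_of_gaussian_bound {g : ℂ → ℂ} {a b c K : ℝ} (hc : 0 < c)
    (hg : DifferentiableOn ℂ g {ζ | ζ.re ∈ uIcc a b})
    (hbd : ∀ ζ : ℂ, ζ.re ∈ uIcc a b → ‖g ζ‖ ≤ K * Real.exp (-c * ζ.im ^ 2)) :
    ∫ φ : ℝ, g (lineZ a φ) = ∫ φ : ℝ, g (lineZ b φ) := by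
  have hint : ∀ r ∈ uIcc a b, Integrable fun φ : ℝ => g (lineZ r φ) := by
    intro r hr
    refine ((integrable_exp_neg_mul_sq hc).const_mul K).mono' ?_ ?_
    · refine (hg.continuousOn.comp_continuous (continuous_lineZ r) fun φ => ?_).aestronglyMeasurable
      simpa using hr
    · filter_upwards with φ
      simpa using hbd (lineZ r φ) (by simpa using hr)
  have hlim : ∀ r ∈ uIcc a b, Tendsto (fun T : ℝ => ∫ φ in (-T)..T, g (lineZ r φ)) atTop
      (nhds (∫ φ : ℝ, g (lineZ r φ))) := fun r hr =>
    intervalIntegral_tendsto_integral (hint r hr) tendsto_neg_atTop_atBot tendsto_id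
  have hedge : ∀ s : ℝ → ℝ, (∀ T, s T ^ 2 = T ^ 2) →
      Tendsto (fun T : ℝ => ∫ x in a..b, g (x + (s T : ℝ) * Complex.I)) atTop (nhds 0) := by
    intro s hs
    have hz : Tendsto (fun T : ℝ => K * Real.exp (-c * T ^ 2) * |b - a|) atTop (nhds 0) := by
      have : Tendsto (fun T : ℝ => Real.exp (-c * T ^ 2)) atTop (nhds 0) :=
        Real.tendsto_exp_atBot.comp
          ((tendsto_pow_atTop two_ne_zero).const_mul_atTop_of_neg (neg_lt_zero.2 hc))
      simpa using (this.const_mul K).mul_const |b - a|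
    refine squeeze_zero_norm (fun T => ?_) hz
    refine intervalIntegral.norm_integral_le_of_norm_le_const fun x hx => ?_
    have := hbd (x + (s T : ℝ) * Complex.I) (by simpa using uIoc_subset_uIcc hx)
    simpa [hs] using this
  have hrect : ∀ T : ℝ, (∫ φ in (-T)..T, g (lineZ b φ)) - (∫ φ in (-T)..T, g (lineZ a φ)) =
      Complex.I * ((∫ x in a..b, g (x + ((-T : ℝ) : ℂ) * Complex.I)) -
        ∫ x in a..b, g (x + (T : ℂ) * Complex.I)) := by
    intro T
    have h := Complex.integral_boundary_rect_eq_zero_of_differentiableOn g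
      (lineZ a (-T)) (lineZ b T) (hg.mono fun ζ hζ => by simpa using hζ.1)
    simp only [lineZ_re, lineZ_im, smul_eq_mul] at h
    unfold lineZ
    linear_combination (-Complex.I) * h + ((∫ φ in (-T)..T, g (b + φ * Complex.I)) -
      ∫ φ in (-T)..T, g (a + φ * Complex.I)) * Complex.I_sq
  have h1 := (hlim b right_mem_uIcc).sub (hlim a left_mem_uIcc)
  have h2 := ((hedge (fun T => -T) (fun T => neg_sq T)).sub
    (hedge (fun T => T) (fun T => rfl))).const_mul Complex.I
  simp only [hrect] at h1
  have h3 := tendsto_nhds_unique h1 h2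
  rw [sub_zero, mul_zero, sub_eq_zero] at h3
  exact h3.symm

/-- Shifting a single contour from `Γ_a` to `Γ_b` in a multiple contour integral, and bounding the
result by means of a Gaussian bound on the shifted contour. -/
lemma norm_integral_le_of_contour_shift {n : ℕ} (q : Fin (n + 1)) {H : (Fin (n + 1) → ℂ) → ℂ}
    {a b c K K' : ℝ} (hc : 0 < c)
    (hH : DifferentiableOn ℂ H {z | (z q).re ∈ uIcc a b ∧ ∀ l ≠ q, (z l).re = a})
    (hK : ∀ z, (z q).re ∈ uIcc a b → (∀ l ≠ q, (z l).re = a) →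
      ‖H z‖ ≤ K * ∏ l, Real.exp (-c * (z l).im ^ 2))
    (hK' : ∀ z, (z q).re = b → (∀ l ≠ q, (z l).re = a) →
      ‖H z‖ ≤ K' * ∏ l, Real.exp (-c * (z l).im ^ 2)) :
    ‖∫ φ : Fin (n + 1) → ℝ, H (fun l => lineZ a (φ l))‖ ≤ K' * √(Real.pi / c) ^ (n + 1) := by
  set G : (Fin (n + 1) → ℝ) → ℂ := fun φ => H (fun l => lineZ a (φ l)) with hG
  have hGint : Integrable G := by
    refine ((Integrable.fintype_prod (𝕜 := ℝ) (f := fun _ : Fin (n + 1) => fun v : ℝ =>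
      Real.exp (-c * v ^ 2)) fun _ => integrable_exp_neg_mul_sq hc).const_mul K).mono' ?_ ?_
    · refine (hH.continuousOn.comp_continuous (by fun_prop) fun φ => ?_).aestronglyMeasurable
      simp
    · filter_upwards with φ
      simpa using hK (fun l => lineZ a (φ l)) (by simp) (by simp)
  have hmp := (volume_preserving_piFinSuccAbove (fun _ : Fin (n + 1) => ℝ) q).symm
  have hsplit : ∫ φ, G φ =
      ∫ s : Fin n → ℝ, ∫ ψ : ℝ, H (q.insertNth (lineZ b ψ) (fun l => lineZ a (s l))) := by
    rw [← hmp.integral_comp', Measure.volume_eq_prod, integral_prod_symm]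
    · refine integral_congr_ae (Eventually.of_forall fun s => ?_)
      have key : ∀ ζ : ℂ, ζ.re ∈ uIcc a b →
          (q.insertNth ζ (fun l => lineZ a (s l)) : Fin (n + 1) → ℂ) ∈
            {z : Fin (n + 1) → ℂ | (z q).re ∈ uIcc a b ∧ ∀ l ≠ q, (z l).re = a} := by
        intro ζ hζ
        refine ⟨by simpa using hζ, fun l hl => ?_⟩
        obtain ⟨m, rfl⟩ := Fin.exists_succAbove_eq hl
        simp
      have hsh := integral_lineZ_eq_of_gaussian_bound (a := a) (b := b)
        (g := fun ζ => H (q.insertNth ζ (fun l => lineZ a (s l))))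
        (K := K * ∏ l, Real.exp (-c * s l ^ 2)) hc ?_ ?_
      · refine Eq.trans ?_ hsh
        refine integral_congr_ae (Eventually.of_forall fun ψ => ?_)
        change H (fun l => lineZ a ((q.insertNth ψ s : Fin (n + 1) → ℝ) l)) = _
        congr 1
        funext l
        refine Fin.succAboveCases q ?_ (fun m => ?_) l <;> simp
      · refine hH.comp (Differentiable.differentiableOn (differentiable_pi.2 fun l => ?_)) key
        refine Fin.succAboveCases q ?_ (fun m => ?_) l <;> simp
      · intro ζ hζ
        refine (hK _ (key ζ hζ).1 (key ζ hζ).2).trans_eq ?_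
        rw [Fin.prod_univ_succAbove _ q]
        simp
        ring
    · have := (hmp.integrable_comp_emb (MeasurableEquiv.measurableEmbedding _)).2 hGint
      rwa [Measure.volume_eq_prod] at this
  rw [hsplit]
  have hin : ∀ s : Fin n → ℝ,
      ‖∫ ψ : ℝ, H (q.insertNth (lineZ b ψ) (fun l => lineZ a (s l)))‖ ≤
        K' * √(Real.pi / c) * ∏ l, Real.exp (-c * s l ^ 2) := by
    intro s
    have : ∫ ψ : ℝ, K' * (∏ l, Real.exp (-c * s l ^ 2)) * Real.exp (-c * ψ ^ 2) =
        K' * √(Real.pi / c) * ∏ l, Real.exp (-c * s l ^ 2) := by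
      rw [integral_const_mul, integral_gaussian]
      ring
    rw [← this]
    refine norm_integral_le_of_norm_le ((integrable_exp_neg_mul_sq hc).const_mul _)
      (Eventually.of_forall fun ψ => ?_)
    refine (hK' _ (by simp) fun l hl => ?_).trans_eq ?_
    · obtain ⟨m, rfl⟩ := Fin.exists_succAbove_eq hl
      simp
    · rw [Fin.prod_univ_succAbove _ q]
      simp
      ring
  refine (norm_integral_le_of_norm_le ((Integrable.fintype_prod (𝕜 := ℝ)
    (f := fun _ : Fin n => fun v : ℝ => Real.exp (-c * v ^ 2))
    fun _ => integrable_exp_neg_mul_sq hc).const_mul _) (Eventually.of_forall hin)).trans_eq ?_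
  rw [integral_const_mul, ← volume_pi,
    integral_fintype_prod_volume_eq_pow (fun v : ℝ => Real.exp (-c * v ^ 2)), integral_gaussian,
    Fintype.card_fin]
  ring

/-- The integrand of `Iperm`, as a function of the complex integration variables. -/
noncomputable def permIntegrand (N : ℕ) (τ : ℝ) (σ : Equiv.Perm (Fin N)) (y x : Fin N → ℝ) (t : ℝ)
    (z : Fin N → ℂ) : ℂ :=
  Aamp N τ σ z *
    ∏ j : Fin N,
      Complex.exp (z (σ j) * ((x j : ℂ) - (y (σ j) : ℂ))) * Complex.exp (z j ^ 2 * (t : ℂ) / 2)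

/-- The number of inversions of a permutation of `Fin N`. -/
def invCount {N : ℕ} (σ : Equiv.Perm (Fin N)) : ℕ :=
  (Finset.univ.filter (fun pr : Fin N × Fin N => pr.1 < pr.2 ∧ σ pr.2 < σ pr.1)).card

lemma norm_Sfac_le {τ d : ℝ} (hτ : τ ∈ Ioo (0 : ℝ) 1) (hd : 0 < d) {z w : ℂ}
    (h : d ≤ z.re - τ * w.re) : ‖Sfac τ z w‖ ≤ d⁻¹ * ((1 + ‖z‖) * (1 + ‖w‖)) := by
  have hden : d ≤ ‖(τ : ℂ) * w - z‖ := by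
    refine h.trans ?_
    have := (neg_le_abs _).trans (Complex.abs_re_le_norm ((τ : ℂ) * w - z))
    simpa using this
  have hnum : ‖(τ : ℂ) * z - w‖ ≤ (1 + ‖z‖) * (1 + ‖w‖) := by
    refine (norm_sub_le _ _).trans ?_
    rw [norm_mul, Complex.norm_real, Real.norm_of_nonneg hτ.1.le]
    nlinarith [hτ.2, norm_nonneg z, norm_nonneg w, mul_nonneg (norm_nonneg z) (norm_nonneg w)]
  rw [Sfac, norm_neg, norm_div, div_eq_inv_mul]
  gcongr

lemma mul_le_prod_one_add_norm {N : ℕ} (z : Fin N → ℂ) {i j : Fin N} (hij : i ≠ j) :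
    (1 + ‖z i‖) * (1 + ‖z j‖) ≤ ∏ l, (1 + ‖z l‖) := by
  rw [← Finset.prod_pair (f := fun l => 1 + ‖z l‖) hij]
  exact Finset.prod_le_prod_of_subset_of_one_le (Finset.subset_univ _)
    (fun l _ => by positivity) fun l _ _ => by simp

lemma norm_Aamp_le {N : ℕ} {τ d : ℝ} (hτ : τ ∈ Ioo (0 : ℝ) 1) (hd : 0 < d)
    (σ : Equiv.Perm (Fin N)) {z : Fin N → ℂ}
    (h : ∀ i j, i < j → σ j < σ i → d ≤ (z (σ i)).re - τ * (z (σ j)).re) :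
    ‖Aamp N τ σ z‖ ≤ d⁻¹ ^ invCount σ * ∏ l, (1 + ‖z l‖) ^ invCount σ := by
  rw [Aamp, norm_prod, Finset.prod_pow, ← mul_pow, invCount, ← Finset.prod_const]
  refine Finset.prod_le_prod (fun _ _ => norm_nonneg _) fun pr hpr => ?_
  simp only [Finset.mem_filter, Finset.mem_univ, true_and] at hpr
  refine (norm_Sfac_le hτ hd (h _ _ hpr.1 hpr.2)).trans ?_
  gcongr
  exact mul_le_prod_one_add_norm z hpr.2.ne'

/-- A polynomial weight is absorbed by half of the Gaussian decay. -/
lemma one_add_norm_pow_mul_norm_exp_le {a R t : ℝ} (ha : 0 < a) (hR : 1 ≤ R) (ht : t = (R ^ 2)⁻¹)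
    (M : ℕ) {z : ℂ} (hz : |z.re| ≤ a + R) :
    (1 + ‖z‖) ^ M * ‖Complex.exp (z ^ 2 * (t : ℂ) / 2)‖ ≤
      R ^ M * Real.exp (M * (2 + a) + M ^ 2 + (a + 1) ^ 2 / 2) *
        Real.exp (-(t / 4) * z.im ^ 2) := by
  have hR0 : 0 < R := by linarith
  set v : ℝ := |z.im| / R with hv
  have hv0 : 0 ≤ v := by positivity
  have him : |z.im| = R * v := by rw [hv]; field_simp
  have htim : t * z.im ^ 2 = v ^ 2 := by
    rw [ht, ← sq_abs z.im, him]; field_simp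
  have h1 : 1 + ‖z‖ ≤ R * Real.exp (2 + a + v) := by
    have h2 : 1 + ‖z‖ ≤ R * (2 + a + v) := by
      have := Complex.norm_le_abs_re_add_abs_im z
      nlinarith
    have h3 := Real.add_one_le_exp (2 + a + v)
    nlinarith
  have htre : t * z.re ^ 2 ≤ (a + 1) ^ 2 := by
    have h4 : z.re ^ 2 ≤ (a + R) ^ 2 := by
      rw [← sq_abs]
      gcongr
    have h5 : a + R ≤ (a + 1) * R := by nlinarith
    have h6 : (a + R) ^ 2 ≤ ((a + 1) * R) ^ 2 := by gcongr
    rw [ht, inv_mul_le_iff₀ (by positivity)]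
    linarith [mul_pow (a + 1) R 2]
  have hexp : ‖Complex.exp (z ^ 2 * (t : ℂ) / 2)‖ =
      Real.exp (t * z.re ^ 2 / 2 - v ^ 2 / 2) := by
    rw [Complex.norm_exp, ← htim]
    congr 1
    have : z ^ 2 * (t : ℂ) / 2 = ((t / 2 : ℝ) : ℂ) * z ^ 2 := by push_cast; ring
    rw [this, Complex.re_ofReal_mul, pow_two, Complex.mul_re]
    ring
  rw [hexp]
  calc (1 + ‖z‖) ^ M * Real.exp (t * z.re ^ 2 / 2 - v ^ 2 / 2)
      ≤ (R * Real.exp (2 + a + v)) ^ M * Real.exp (t * z.re ^ 2 / 2 - v ^ 2 / 2) := by gcongr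
    _ = R ^ M * Real.exp (M * (2 + a + v) + (t * z.re ^ 2 / 2 - v ^ 2 / 2)) := by
      rw [mul_pow, ← Real.exp_nat_mul, Real.exp_add]
      ring
    _ ≤ R ^ M * Real.exp (M * (2 + a) + M ^ 2 + (a + 1) ^ 2 / 2 + -(t / 4) * z.im ^ 2) := by
      gcongr ?_ * ?_
      rw [Real.exp_le_exp]
      nlinarith [sq_nonneg ((M : ℝ) - v / 2)]
    _ = _ := by rw [Real.exp_add]; ring

lemma norm_permIntegrand_le {N : ℕ} {τ a d E R t : ℝ} (hτ : τ ∈ Ioo (0 : ℝ) 1) (ha : 0 < a)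
    (hd : 0 < d) (hR : 1 ≤ R) (ht : t = (R ^ 2)⁻¹) (σ : Equiv.Perm (Fin N)) (y x : Fin N → ℝ)
    {z : Fin N → ℂ}
    (h : ∀ i j, i < j → σ j < σ i → d ≤ (z (σ i)).re - τ * (z (σ j)).re)
    (hz : ∀ l, |(z l).re| ≤ a + R) (hE : ∑ j, (z (σ j)).re * (x j - y (σ j)) ≤ E) :
    ‖permIntegrand N τ σ y x t z‖ ≤
      d⁻¹ ^ invCount σ *
        (R ^ invCount σ * Real.exp (invCount σ * (2 + a) + invCount σ ^ 2 + (a + 1) ^ 2 / 2)) ^ N *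
        Real.exp E * ∏ l, Real.exp (-(t / 4) * (z l).im ^ 2) := by
  have h1 : ∏ l, ((1 + ‖z l‖) ^ invCount σ * ‖Complex.exp (z l ^ 2 * (t : ℂ) / 2)‖) ≤
      (R ^ invCount σ * Real.exp (invCount σ * (2 + a) + invCount σ ^ 2 + (a + 1) ^ 2 / 2)) ^ N *
        ∏ l, Real.exp (-(t / 4) * (z l).im ^ 2) := by
    have h0 := Finset.prod_le_prod (s := Finset.univ) (fun l _ => by positivity) fun l _ =>
      one_add_norm_pow_mul_norm_exp_le ha hR ht (invCount σ) (hz l)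
    rwa [Finset.prod_mul_distrib (s := Finset.univ) (g := fun l => Real.exp (-(t / 4) * (z l).im ^ 2)),
      Finset.prod_const, Finset.card_univ, Fintype.card_fin] at h0
  have h2 : ∏ j, ‖Complex.exp (z (σ j) * ((x j : ℂ) - (y (σ j) : ℂ)))‖ ≤ Real.exp E := by
    have : ∀ j, ‖Complex.exp (z (σ j) * ((x j : ℂ) - (y (σ j) : ℂ)))‖ =
        Real.exp ((z (σ j)).re * (x j - y (σ j))) := by
      intro j
      rw [Complex.norm_exp, ← Complex.ofReal_sub, Complex.re_mul_ofReal]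
    simp only [this]
    rw [← Real.exp_sum]
    exact Real.exp_le_exp.2 hE
  rw [permIntegrand, norm_mul, norm_prod]
  simp only [norm_mul]
  rw [Finset.prod_mul_distrib]
  calc _ ≤ (d⁻¹ ^ invCount σ * ∏ l, (1 + ‖z l‖) ^ invCount σ) *
        (Real.exp E * ∏ l, ‖Complex.exp (z l ^ 2 * (t : ℂ) / 2)‖) := by
        gcongr
        exact norm_Aamp_le hτ hd σ h
    _ = d⁻¹ ^ invCount σ * Real.exp E *
        ∏ l, ((1 + ‖z l‖) ^ invCount σ * ‖Complex.exp (z l ^ 2 * (t : ℂ) / 2)‖) := by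
        rw [Finset.prod_mul_distrib]; ring
    _ ≤ d⁻¹ ^ invCount σ * Real.exp E *
        ((R ^ invCount σ * Real.exp (invCount σ * (2 + a) + invCount σ ^ 2 + (a + 1) ^ 2 / 2)) ^ N *
          ∏ l, Real.exp (-(t / 4) * (z l).im ^ 2)) := by gcongr
    _ = _ := by ring

lemma differentiableOn_finset_prod_apply {ι E : Type*} [NormedAddCommGroup E] [NormedSpace ℂ E]
    {u : Finset ι} {g : ι → E → ℂ} {s : Set E} (hg : ∀ i ∈ u, DifferentiableOn ℂ (g i) s) :
    DifferentiableOn ℂ (fun z => ∏ i ∈ u, g i z) s := by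
  classical
  exact fun z hz => (HasFDerivWithinAt.finsetProd fun i hi =>
    (hg i hi z hz).hasFDerivWithinAt).differentiableWithinAt

lemma differentiableOn_permIntegrand {N : ℕ} {τ d : ℝ} (hd : 0 < d) (σ : Equiv.Perm (Fin N))
    (y x : Fin N → ℝ) (t : ℝ) :
    DifferentiableOn ℂ (permIntegrand N τ σ y x t)
      {z | ∀ i j, i < j → σ j < σ i → d ≤ (z (σ i)).re - τ * (z (σ j)).re} := by
  unfold permIntegrand Aamp Sfac
  refine DifferentiableOn.mul (differentiableOn_finset_prod_apply fun pr hpr => ?_)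
    (differentiableOn_finset_prod_apply fun j _ => Differentiable.differentiableOn ?_)
  · simp only [Finset.mem_filter, Finset.mem_univ, true_and] at hpr
    simp only [div_eq_mul_inv]
    refine DifferentiableOn.fun_neg (DifferentiableOn.fun_mul (by fun_prop)
      (DifferentiableOn.fun_inv (by fun_prop) fun z hz h0 => ?_))
    have h1 := hz _ _ hpr.1 hpr.2
    have h2 := congrArg Complex.re h0
    simp at h2
    linarith
  · fun_prop

/-- Shifting the contour of `z_{σ(p)}` to `Γ_{a+s}`: to the right if `p` is the second entry of no
inversion, to the left if `p` is the first entry of no inversion. -/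
lemma norm_Iperm_le {n : ℕ} {τ a R s B δ : ℝ} (hτ : τ ∈ Ioo (0 : ℝ) 1) (ha : 0 < a)
    (hR : 1 ≤ R) (σ : Equiv.Perm (Fin (n + 1))) (y x : Fin (n + 1) → ℝ) (p : Fin (n + 1))
    (hs : |s| ≤ R) (hp : (0 ≤ s ∧ ∀ i < p, σ i < σ p) ∨ (s ≤ 0 ∧ ∀ i > p, σ p < σ i))
    (hB : a * ∑ j, (x j - y (σ j)) ≤ B) (hδ : 0 ≤ δ) (hu : s * (x p - y (σ p)) ≤ -δ) :
    ‖Iperm (n + 1) τ a σ y x (R ^ 2)⁻¹‖ ≤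
      (1 / (2 * Real.pi)) ^ (n + 1) * (((1 - τ) * a)⁻¹ ^ invCount σ *
        (R ^ invCount σ *
          Real.exp (invCount σ * (2 + a) + invCount σ ^ 2 + (a + 1) ^ 2 / 2)) ^ (n + 1) *
        Real.exp (B - δ) * (√(4 * Real.pi) * R) ^ (n + 1)) := by
  have hd : 0 < (1 - τ) * a := mul_pos (by linarith [hτ.2]) ha
  have hR0 : 0 < R := by linarith
  have hsum : ∀ z : Fin (n + 1) → ℂ, (∀ l ≠ σ p, (z l).re = a) →
      ∑ j, (z (σ j)).re * (x j - y (σ j)) =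
        a * ∑ j, (x j - y (σ j)) + ((z (σ p)).re - a) * (x p - y (σ p)) := by
    intro z hz
    rw [Finset.mul_sum, ← Finset.add_sum_erase _ _ (Finset.mem_univ p),
      ← Finset.add_sum_erase (a := p) Finset.univ (fun j => a * (x j - y (σ j))) (Finset.mem_univ p),
      Finset.sum_congr rfl fun j hj => by
        rw [hz (σ j) (σ.injective.ne (Finset.ne_of_mem_erase hj))]]
    ring
  have hstrip : ∀ z : Fin (n + 1) → ℂ, (z (σ p)).re ∈ uIcc a (a + s) →
      (∀ l ≠ σ p, (z l).re = a) →
      (∀ i j, i < j → σ j < σ i → (1 - τ) * a ≤ (z (σ i)).re - τ * (z (σ j)).re) ∧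
        ∀ l, |(z l).re| ≤ a + R := by
    intro z hz hz'
    have habs : |(z (σ p)).re - a| ≤ R := by
      have := abs_sub_left_of_mem_uIcc hz
      rw [add_sub_cancel_left] at this
      exact this.trans hs
    refine ⟨fun i j hij hinv => ?_, fun l => ?_⟩
    · rcases hp with ⟨hs0, hp⟩ | ⟨hs0, hp⟩
      · have hj : j ≠ p := by
          rintro rfl
          exact lt_asymm hinv (hp i hij)
        rw [hz' (σ j) (σ.injective.ne hj)]
        rw [uIcc_of_le (by linarith)] at hz
        by_cases hi : i = p
        · subst hi
          linarith [hz.1]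
        · rw [hz' (σ i) (σ.injective.ne hi)]
          linarith
      · have hi : i ≠ p := by
          rintro rfl
          exact lt_asymm hinv (hp j hij)
        rw [hz' (σ i) (σ.injective.ne hi)]
        rw [uIcc_of_ge (by linarith)] at hz
        by_cases hj : j = p
        · subst hj
          nlinarith [hz.2, hτ.1]
        · rw [hz' (σ j) (σ.injective.ne hj)]
          linarith
    · by_cases hl : l = σ p
      · rw [hl]
        rw [abs_le] at habs ⊢
        constructor <;> linarith [habs.1, habs.2]
      · rw [hz' l hl, abs_of_pos ha]
        linarith
  have hin : ∀ r ∈ uIcc a (a + s), (r - a) * (x p - y (σ p)) ≤ 0 := by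
    intro r hr
    rcases le_total 0 s with h0 | h0
    · rw [uIcc_of_le (by linarith)] at hr
      rcases h0.eq_or_lt with rfl | h0
      · have : r = a := by linarith [hr.1, hr.2]
        simp [this]
      · have : x p - y (σ p) ≤ 0 := by
          by_contra! h
          nlinarith
        nlinarith [hr.1]
    · rw [uIcc_of_ge (by linarith)] at hr
      rcases h0.eq_or_lt with rfl | h0
      · have : r = a := by linarith [hr.1, hr.2]
        simp [this]
      · have : 0 ≤ x p - y (σ p) := by
          by_contra! h
          nlinarith
        nlinarith [hr.2]
  have hshift := norm_integral_le_of_contour_shift (σ p) (c := (R ^ 2)⁻¹ / 4) (a := a) (b := a + s)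
    (H := permIntegrand (n + 1) τ σ y x (R ^ 2)⁻¹) (by positivity)
    ((differentiableOn_permIntegrand hd σ y x _).mono fun z hz => (hstrip z hz.1 hz.2).1)
    (fun z hz hz' => norm_permIntegrand_le hτ ha hd hR rfl σ y x (hstrip z hz hz').1
      (hstrip z hz hz').2 (E := B) (by rw [hsum z hz']; linarith [hin _ hz]))
    (fun z hz hz' => norm_permIntegrand_le hτ ha hd hR rfl σ y x
      (hstrip z (hz ▸ right_mem_uIcc) hz').1 (hstrip z (hz ▸ right_mem_uIcc) hz').2
      (E := B - δ) (by rw [hsum z hz', hz, add_sub_cancel_left]; linarith))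
  have hsqrt : √(Real.pi / ((R ^ 2)⁻¹ / 4)) = √(4 * Real.pi) * R := by
    rw [show Real.pi / ((R ^ 2)⁻¹ / 4) = 4 * Real.pi * R ^ 2 by field_simp,
      Real.sqrt_mul (by positivity), Real.sqrt_sq hR0.le]
  rw [hsqrt] at hshift
  have hpre : ‖(1 / (2 * (Real.pi : ℂ))) ^ (n + 1)‖ = (1 / (2 * Real.pi)) ^ (n + 1) := by
    simp [abs_of_pos Real.pi_pos]
  rw [Iperm, norm_mul, hpre]
  gcongr
  exact hshift

/-- A nontrivial permutation has an inversion between a left-to-right maximum and a right-to-left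
minimum. -/
lemma exists_extremal_inversion {N : ℕ} {σ : Equiv.Perm (Fin N)} (hσ : σ ≠ 1) :
    ∃ j k, j < k ∧ σ k < σ j ∧ (∀ i < j, σ i < σ j) ∧ ∀ i > k, σ k < σ i := by
  obtain ⟨i, k, hik, hinv⟩ : ∃ i k, i < k ∧ σ k < σ i := by
    by_contra! h
    have hmono : StrictMono σ := fun i k hik => (h i k hik).lt_of_ne (σ.injective.ne hik.ne)
    refine hσ (Equiv.ext fun i => ?_)
    exact congrFun ((hmono.range_inj strictMono_id).1 (by simp)) i
  obtain ⟨j, hj, hjmax⟩ := (Finset.Iic i).exists_max_image σ ⟨i, by simp⟩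
  obtain ⟨l, hl, hlmin⟩ := (Finset.Ici k).exists_min_image σ ⟨k, by simp⟩
  rw [Finset.mem_Iic] at hj
  rw [Finset.mem_Ici] at hl
  refine ⟨j, l, hj.trans_lt (hik.trans_le hl),
    (hlmin k (by simp)).trans_lt (hinv.trans_le (hjmax i (by simp))), fun m hm => ?_, fun m hm => ?_⟩
  · exact (hjmax m (Finset.mem_Iic.2 (hm.le.trans hj))).lt_of_ne (σ.injective.ne hm.ne)
  · exact (hlmin m (Finset.mem_Ici.2 (hl.trans hm.le))).lt_of_ne (σ.injective.ne hm.ne)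

lemma add_le_of_mem_WeylPlusEps {N : ℕ} {ε : ℝ} {x : Fin N → ℝ} (hx : x ∈ WeylPlusEps N ε)
    {j k : Fin N} (hjk : j < k) : x j + ε ≤ x k := by
  have hj : (j : ℕ) + 1 < N := lt_of_le_of_lt hjk k.2
  have h1 := hx.2 j hj
  have h2 : x ⟨(j : ℕ) + 1, hj⟩ ≤ x k := hx.1 (Fin.le_def.2 hjk)
  linarith

/-- For `σ ≠ id`, `y ∈ W_N^+`, and a test function `f` smooth with compact support in
`W_{N,ε}^+`, the contribution `∫ f(x) I_σ(y;x,t) dx` vanishes as `t → 0+`. -/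
theorem Iperm_initial_vanishes (N : ℕ) (hN : 1 ≤ N) (τ : ℝ) (hτ : τ ∈ Set.Ioo (0 : ℝ) 1)
    (a : ℝ) (ha : 0 < a) (σ : Equiv.Perm (Fin N)) (hσ : σ ≠ 1)
    (y : Fin N → ℝ) (hy : y ∈ WeylPlus N) (ε : ℝ) (hε : 0 < ε)
    (f : (Fin N → ℝ) → ℝ) (hf : ContDiff ℝ (⊤ : ℕ∞) f) (hfc : HasCompactSupport f)
    (hsupp : tsupport f ⊆ WeylPlusEps N ε) :
    Filter.Tendsto (fun t : ℝ => ∫ x : Fin N → ℝ, (f x : ℂ) * Iperm N τ a σ y x t)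
      (nhdsWithin 0 (Set.Ioi 0)) (nhds 0) := by
  obtain ⟨n, rfl⟩ : ∃ n, N = n + 1 := ⟨N - 1, by omega⟩
  obtain ⟨j, k, hjk, hinv, hj, hk⟩ := exists_extremal_inversion hσ
  obtain ⟨B, hB⟩ := hfc.isCompact.bddAbove_image
    (f := fun x : Fin (n + 1) → ℝ => a * ∑ i, (x i - y (σ i))) (by fun_prop)
  have hbound : ∀ R : ℝ, 1 ≤ R → ∀ x ∈ tsupport f, ‖Iperm (n + 1) τ a σ y x (R ^ 2)⁻¹‖ ≤
      (1 / (2 * Real.pi)) ^ (n + 1) * (((1 - τ) * a)⁻¹ ^ invCount σ *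
        (R ^ invCount σ *
          Real.exp (invCount σ * (2 + a) + invCount σ ^ 2 + (a + 1) ^ 2 / 2)) ^ (n + 1) *
        Real.exp (B - R * (ε / 2)) * (√(4 * Real.pi) * R) ^ (n + 1)) := by
    intro R hR x hx
    have hBx := hB (mem_image_of_mem _ hx)
    have hyle : y (σ k) ≤ y (σ j) := hy hinv.le
    have hxle := add_le_of_mem_WeylPlusEps (hsupp hx) hjk
    have hRε : 0 ≤ R * (ε / 2) := by positivity
    have hR0 : 0 ≤ R := by linarith
    by_cases h : x j - y (σ j) ≤ -(ε / 2)
    · exact norm_Iperm_le hτ ha hR σ y x j (s := R) (abs_of_nonneg hR0).le (Or.inl ⟨hR0, hj⟩) hBx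
        hRε (by nlinarith)
    · exact norm_Iperm_le hτ ha hR σ y x k (s := -R) (by rw [abs_neg, abs_of_nonneg hR0])
        (Or.inr ⟨by linarith, hk⟩) hBx hRε (by nlinarith)
  set M := invCount σ with hM
  set C : ℝ := (1 / (2 * Real.pi)) ^ (n + 1) * (((1 - τ) * a)⁻¹ ^ M *
    Real.exp (M * (2 + a) + M ^ 2 + (a + 1) ^ 2 / 2) ^ (n + 1) * Real.exp B *
      √(4 * Real.pi) ^ (n + 1)) with hC
  have hlim : Tendsto (fun t : ℝ => (∫ x, ‖f x‖) * (C * ((√t)⁻¹ ^ (((M + 1) * (n + 1) : ℕ) : ℝ) *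
      Real.exp (-(ε / 2) * (√t)⁻¹)))) (nhdsWithin 0 (Ioi 0)) (nhds 0) := by
    have hsq : Tendsto (fun t : ℝ => (√t)⁻¹) (nhdsWithin 0 (Ioi 0)) atTop := by
      refine tendsto_inv_nhdsGT_zero.comp (tendsto_nhdsWithin_iff.2 ⟨?_, ?_⟩)
      · simpa using (Real.continuous_sqrt.tendsto 0).mono_left nhdsWithin_le_nhds
      · filter_upwards [self_mem_nhdsWithin] with t ht using Real.sqrt_pos.2 ht
    simpa using (((tendsto_rpow_mul_exp_neg_mul_atTop_nhds_zero
      (((M + 1) * (n + 1) : ℕ) : ℝ) (ε / 2) (by positivity)).comp hsq).const_mul C).const_mul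
        (∫ x, ‖f x‖)
  refine squeeze_zero_norm' ?_ hlim
  filter_upwards [Ioo_mem_nhdsGT (zero_lt_one' ℝ)] with t ht
  have hst : 0 < √t := Real.sqrt_pos.2 ht.1
  have hR : 1 ≤ (√t)⁻¹ := (one_le_inv₀ hst).2 (Real.sqrt_le_one.2 ht.2.le)
  have htR : t = ((√t)⁻¹ ^ 2)⁻¹ := by rw [inv_pow, inv_inv, Real.sq_sqrt ht.1.le]
  rw [← integral_mul_const]
  refine norm_integral_le_of_norm_le
    ((hf.continuous.integrable_of_hasCompactSupport hfc).norm.mul_const _)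
    (Eventually.of_forall fun x => ?_)
  rw [norm_mul, Complex.norm_real]
  by_cases hx : x ∈ tsupport f
  · refine mul_le_mul_of_nonneg_left ?_ (norm_nonneg _)
    have := hbound _ hR x hx
    rw [← htR] at this
    refine this.trans_eq ?_
    rw [hC, Real.rpow_natCast,
      show B - (√t)⁻¹ * (ε / 2) = B + -(ε / 2) * (√t)⁻¹ by ring, Real.exp_add B]
    generalize Real.exp (M * (2 + a) + M ^ 2 + (a + 1) ^ 2 / 2) = D
    ring
  · simp [image_eq_zero_of_notMem_tsupport hx]
end

section
/- Let ε > 0 and let f : ℝ^N → ℝ be smooth with compact support contained in W_{N,ε}^+. Then for every y ∈ W_N^+, lim_{t→0+} ∫_{ℝ^N} f(x) Q_y(x,t) dx = f(y). -/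
open MeasureTheory Filter Set

/-- Two integrable functions on `ℝ^N` whose integrals in one fixed coordinate agree have the same
integral. -/
theorem integral_eq_of_integral_update_eq {N : ℕ} (α : Fin N) {G₁ G₂ : (Fin N → ℝ) → ℂ}
    (h₁ : Integrable G₁) (h₂ : Integrable G₂)
    (h : ∀ φ : Fin N → ℝ,
      ∫ u : ℝ, G₁ (Function.update φ α u) = ∫ u : ℝ, G₂ (Function.update φ α u)) :
    ∫ φ, G₁ φ = ∫ φ, G₂ φ := by
  obtain _ | n := N
  · exact α.elim0
  have mp := (volume_preserving_piFinSuccAbove (fun _ : Fin (n + 1) => ℝ) α).symm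
  have key : ∀ G : (Fin (n + 1) → ℝ) → ℂ, Integrable G →
      ∫ φ, G φ = ∫ v : Fin n → ℝ, ∫ u : ℝ, G (α.insertNth u v) := by
    intro G hG
    rw [← mp.integral_comp' G]
    exact integral_prod_symm _ ((mp.integrable_comp_emb (MeasurableEquiv.measurableEmbedding _)).2 hG)
  rw [key G₁ h₁, key G₂ h₂]
  congr 1
  ext v
  simpa [Fin.update_insertNth] using h (α.insertNth 0 v)

/-- Cauchy's theorem for two vertical lines: a function holomorphic on the closed strip between
them, with Gaussian decay there, has the same integral along both. -/
theorem integral_lineZ_eq_of_gaussian_bound_s6 {h : ℂ → ℂ} {s₁ s₂ b C : ℝ} (hb : 0 < b)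
    (hd : ∀ z : ℂ, z.re ∈ uIcc s₁ s₂ → DifferentiableAt ℂ h z)
    (hbd : ∀ s ∈ uIcc s₁ s₂, ∀ u : ℝ, ‖h (lineZ s u)‖ ≤ C * Real.exp (-b * u ^ 2)) :
    ∫ u : ℝ, h (lineZ s₁ u) = ∫ u : ℝ, h (lineZ s₂ u) := by
  have hint : ∀ s ∈ uIcc s₁ s₂, Integrable (fun u : ℝ => h (lineZ s u)) := by
    intro s hs
    refine ((integrable_exp_neg_mul_sq hb).const_mul C).mono' ?_ (.of_forall fun u => hbd s hs u)
    refine Continuous.aestronglyMeasurable (continuous_iff_continuousAt.2 fun u => ?_)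
    have h1 : ContinuousAt h (lineZ s u) := (hd _ (by simpa [lineZ] using hs)).continuousAt
    exact h1.comp (f := fun u : ℝ => lineZ s u) (by unfold lineZ; fun_prop)
  have hdecay : Tendsto (fun T : ℝ => C * Real.exp (-b * T ^ 2) * |s₂ - s₁|) atTop (nhds 0) := by
    have h1 : Tendsto (fun T : ℝ => Real.exp (-b * T ^ 2)) atTop (nhds 0) := by
      refine Real.tendsto_exp_atBot.comp ?_
      exact (tendsto_pow_atTop two_ne_zero).const_mul_atTop_of_neg (by linarith)
    simpa using (h1.const_mul C).mul_const |s₂ - s₁|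
  have hhor : ∀ e : ℝ, (e = 1 ∨ e = -1) →
      Tendsto (fun T : ℝ => ∫ x in s₁..s₂, h (lineZ x (e * T))) atTop (nhds 0) := by
    intro e he
    refine squeeze_zero_norm (fun T => ?_) hdecay
    refine intervalIntegral.norm_integral_le_of_norm_le_const fun x hx => ?_
    refine (hbd x (uIoc_subset_uIcc hx) _).trans_eq ?_
    rcases he with rfl | rfl <;> simp
  have hver : ∀ s ∈ uIcc s₁ s₂, Tendsto (fun T : ℝ => ∫ u in (-T)..T, h (lineZ s u)) atTop
      (nhds (∫ u : ℝ, h (lineZ s u))) := fun s hs =>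
    intervalIntegral_tendsto_integral (hint s hs) tendsto_neg_atTop_atBot tendsto_id
  have hlim := (((hhor (-1) (.inr rfl)).sub (hhor 1 (.inl rfl))).add
    ((hver s₂ right_mem_uIcc).const_smul Complex.I)).sub
    ((hver s₁ left_mem_uIcc).const_smul Complex.I)
  have hzero : ∀ T : ℝ, (∫ x in s₁..s₂, h (lineZ x (-1 * T))) - (∫ x in s₁..s₂, h (lineZ x (1 * T)))
      + Complex.I • (∫ u in (-T)..T, h (lineZ s₂ u))
      - Complex.I • (∫ u in (-T)..T, h (lineZ s₁ u)) = 0 := by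
    intro T
    have := Complex.integral_boundary_rect_eq_zero_of_differentiableOn h
      (lineZ s₁ (-T)) (lineZ s₂ T)
      (fun z hz => (hd z (by simpa [lineZ] using hz.1)).differentiableWithinAt)
    simpa [lineZ] using this
  simp only [hzero] at hlim
  have h0 := tendsto_nhds_unique hlim tendsto_const_nhds
  rw [sub_zero, zero_add, ← smul_sub, smul_eq_zero_iff_right Complex.I_ne_zero] at h0
  exact (sub_eq_zero.1 h0).symm

/-- The integrand of `Iperm` as a function of the complex spectral variables. -/
noncomputable def betheIntegrand (N : ℕ) (τ : ℝ) (σ : Equiv.Perm (Fin N)) (y x : Fin N → ℝ)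
    (t : ℝ) (z : Fin N → ℂ) : ℂ :=
  Aamp N τ σ z * ∏ j : Fin N, Complex.exp (z (σ j) * ((x j : ℂ) - (y (σ j) : ℂ))) *
    Complex.exp (z j ^ 2 * (t : ℂ) / 2)

/-- The real parts `c` stay at distance at least `δ` to the right of the poles of `Aamp`. -/
def AvoidsPoles (N : ℕ) (τ : ℝ) (σ : Equiv.Perm (Fin N)) (δ : ℝ) (c : Fin N → ℝ) : Prop :=
  ∀ i j, i < j → σ j < σ i → δ ≤ c (σ i) - τ * c (σ j)

/-- The number of inversions of a permutation. -/
def numInv {N : ℕ} (σ : Equiv.Perm (Fin N)) : ℕ :=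
  (Finset.univ.filter (fun pr : Fin N × Fin N => pr.1 < pr.2 ∧ σ pr.2 < σ pr.1)).card

theorem norm_Sfac_le_s6 {τ δ : ℝ} (hτ : τ ∈ Ioo (0 : ℝ) 1) (hδ : 0 < δ) {zα zβ : ℂ}
    (h : δ ≤ zα.re - τ * zβ.re) : ‖Sfac τ zα zβ‖ ≤ (‖zα‖ + ‖zβ‖) / δ := by
  rw [Sfac, norm_neg, norm_div]
  have hnum : ‖(τ : ℂ) * zα - zβ‖ ≤ ‖zα‖ + ‖zβ‖ := by
    refine (norm_sub_le _ _).trans ?_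
    rw [norm_mul, Complex.norm_real, Real.norm_of_nonneg hτ.1.le]
    nlinarith [norm_nonneg zα, hτ.2]
  have hden : δ ≤ ‖(τ : ℂ) * zβ - zα‖ := by
    refine le_trans ?_ (Complex.abs_re_le_norm _)
    rw [Complex.sub_re, Complex.re_ofReal_mul, abs_sub_comm]
    exact h.trans (le_abs_self _)
  gcongr

theorem one_add_abs_pow_mul_exp_le (m : ℕ) {t : ℝ} (ht : 0 < t) (ht1 : t ≤ 1) (u : ℝ) :
    (1 + |u|) ^ m * Real.exp (-(t / 2) * u ^ 2) ≤
      m.factorial * Real.exp 2 * (1 / t) ^ m * Real.exp (-(t / 4) * u ^ 2) := by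
  have h1 := Real.pow_div_factorial_le_exp (t * (1 + |u|)) (by positivity) m
  rw [div_le_iff₀ (by positivity), mul_pow] at h1
  have h2 : (1 + |u|) ^ m ≤ m.factorial * (1 / t) ^ m * Real.exp (t * (1 + |u|)) := by
    rw [one_div, inv_pow, mul_assoc, mul_left_comm, ← div_eq_inv_mul, le_div_iff₀ (by positivity)]
    linarith
  calc _ ≤ m.factorial * (1 / t) ^ m * Real.exp (t * (1 + |u|)) * Real.exp (-(t / 2) * u ^ 2) := by
        gcongr
    _ = m.factorial * (1 / t) ^ m * Real.exp (t * (1 + |u|) + -(t / 2) * u ^ 2) := by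
        rw [Real.exp_add]; ring
    _ ≤ m.factorial * (1 / t) ^ m * Real.exp (2 + -(t / 4) * u ^ 2) := by
        refine mul_le_mul_of_nonneg_left (Real.exp_le_exp.2 ?_) (by positivity)
        rw [← sq_abs u]
        nlinarith [sq_nonneg (|u| / 2 - 1), mul_nonneg ht.le (sq_nonneg (|u| / 2 - 1))]
    _ = _ := by rw [Real.exp_add]; ring

theorem norm_Aamp_le_s6 {N : ℕ} {τ δ K : ℝ} (hτ : τ ∈ Ioo (0 : ℝ) 1) (hδ : 0 < δ)
    {σ : Equiv.Perm (Fin N)} {c : Fin N → ℝ} (hc : AvoidsPoles N τ σ δ c) (hK1 : 1 ≤ K)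
    (hK : ∀ j, |c j| ≤ K) (φ : Fin N → ℝ) :
    ‖Aamp N τ σ (fun j => lineZ (c j) (φ j))‖ ≤
      (2 * K / δ) ^ numInv σ * ∏ j, (1 + |φ j|) ^ numInv σ := by
  have hz : ∀ i, ‖lineZ (c i) (φ i)‖ ≤ K * ∏ j, (1 + |φ j|) := by
    intro i
    have h1 : ‖lineZ (c i) (φ i)‖ ≤ |c i| + |φ i| := by
      unfold lineZ
      refine (norm_add_le _ _).trans ?_
      simp
    have h2 : 1 + |φ i| ≤ ∏ j, (1 + |φ j|) := by
      have h3 : ∏ j ∈ {i}, (1 + |φ j|) ≤ ∏ j, (1 + |φ j|) :=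
        Finset.prod_le_prod_of_subset_of_one_le (Finset.subset_univ _)
          (fun j _ => by positivity) (fun j _ _ => by linarith [abs_nonneg (φ j)])
      simpa using h3
    nlinarith [hK i, abs_nonneg (φ i)]
  rw [Finset.prod_pow, ← mul_pow, Aamp, norm_prod, numInv, ← Finset.prod_const]
  refine Finset.prod_le_prod (fun _ _ => norm_nonneg _) fun pr hpr => ?_
  have hpr' := (Finset.mem_filter.1 hpr).2
  refine (norm_Sfac_le_s6 hτ hδ ?_).trans ?_
  · simpa [lineZ] using hc _ _ hpr'.1 hpr'.2
  · rw [div_mul_eq_mul_div]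
    gcongr
    linarith [hz (σ pr.1), hz (σ pr.2)]

/-- Gaussian bound for the Bethe integrand on a product of vertical lines avoiding the poles. -/
theorem norm_betheIntegrand_le {N : ℕ} {τ δ K t : ℝ} (hτ : τ ∈ Ioo (0 : ℝ) 1) (hδ : 0 < δ)
    {σ : Equiv.Perm (Fin N)} {c : Fin N → ℝ} (hc : AvoidsPoles N τ σ δ c) (hK1 : 1 ≤ K)
    (hK : ∀ j, |c j| ≤ K) (ht : 0 < t) (ht1 : t ≤ 1) (y x φ : Fin N → ℝ) :
    ‖betheIntegrand N τ σ y x t (fun j => lineZ (c j) (φ j))‖ ≤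
      (2 * K / δ) ^ numInv σ *
        ((numInv σ).factorial * Real.exp 2 * (1 / t) ^ numInv σ) ^ N *
        Real.exp (∑ j, c (σ j) * (x j - y (σ j)) + t / 2 * ∑ j, c j ^ 2) *
        ∏ j, Real.exp (-(t / 4) * φ j ^ 2) := by
  have hexp : ‖∏ j : Fin N, Complex.exp (lineZ (c (σ j)) (φ (σ j)) * ((x j : ℂ) - (y (σ j) : ℂ))) *
      Complex.exp (lineZ (c j) (φ j) ^ 2 * (t : ℂ) / 2)‖ =
      Real.exp (∑ j, c (σ j) * (x j - y (σ j)) + t / 2 * ∑ j, c j ^ 2) *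
        ∏ j, Real.exp (-(t / 2) * φ j ^ 2) := by
    rw [norm_prod, Real.exp_add, Finset.mul_sum, Real.exp_sum, Real.exp_sum,
      ← Finset.prod_mul_distrib, ← Finset.prod_mul_distrib]
    refine Finset.prod_congr rfl fun j _ => ?_
    rw [norm_mul, Complex.norm_exp, Complex.norm_exp, mul_assoc]
    congr 1
    · simp [lineZ]
    · have : lineZ (c j) (φ j) ^ 2 * (t : ℂ) / 2 =
          ((t / 2 * c j ^ 2 + -(t / 2) * φ j ^ 2 : ℝ) : ℂ)
            + ((c j * φ j * t : ℝ) : ℂ) * Complex.I := by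
        unfold lineZ
        push_cast
        ring_nf
        rw [Complex.I_sq]
        ring
      rw [← Real.exp_add, this, Complex.add_re, Complex.ofReal_re, Complex.re_ofReal_mul]
      simp
  rw [betheIntegrand, norm_mul, hexp]
  have hA := norm_Aamp_le_s6 hτ hδ hc hK1 hK φ
  calc _ ≤ ((2 * K / δ) ^ numInv σ * ∏ j, (1 + |φ j|) ^ numInv σ) *
        (Real.exp (∑ j, c (σ j) * (x j - y (σ j)) + t / 2 * ∑ j, c j ^ 2) *
        ∏ j, Real.exp (-(t / 2) * φ j ^ 2)) := by gcongr
    _ = (2 * K / δ) ^ numInv σ * Real.exp (∑ j, c (σ j) * (x j - y (σ j)) + t / 2 * ∑ j, c j ^ 2) *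
        ∏ j, ((1 + |φ j|) ^ numInv σ * Real.exp (-(t / 2) * φ j ^ 2)) := by
        rw [Finset.prod_mul_distrib]; ring
    _ ≤ (2 * K / δ) ^ numInv σ * Real.exp (∑ j, c (σ j) * (x j - y (σ j)) + t / 2 * ∑ j, c j ^ 2) *
        ∏ j, (((numInv σ).factorial * Real.exp 2 * (1 / t) ^ numInv σ) *
          Real.exp (-(t / 4) * φ j ^ 2)) := by
        refine mul_le_mul_of_nonneg_left (Finset.prod_le_prod (fun j _ => by positivity)
          fun j _ => one_add_abs_pow_mul_exp_le _ ht ht1 _) (by positivity)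
    _ = _ := by
        rw [Finset.prod_mul_distrib, Finset.prod_const, Finset.card_univ, Fintype.card_fin]
        ring

theorem measurable_betheIntegrand (N : ℕ) (τ : ℝ) (σ : Equiv.Perm (Fin N)) (y : Fin N → ℝ)
    (t : ℝ) : Measurable (fun p : (Fin N → ℝ) × (Fin N → ℂ) =>
      betheIntegrand N τ σ y p.1 t p.2) := by
  unfold betheIntegrand Aamp Sfac
  fun_prop

theorem integrable_prod_exp_neg_mul_sq (N : ℕ) {b : ℝ} (hb : 0 < b) :
    Integrable (fun φ : Fin N → ℝ => ∏ j, Real.exp (-b * φ j ^ 2)) :=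
  Integrable.fintype_prod (f := fun (_ : Fin N) u => Real.exp (-b * u ^ 2))
    fun _ => integrable_exp_neg_mul_sq hb

theorem integrable_betheIntegrand {N : ℕ} {τ δ t : ℝ} (hτ : τ ∈ Ioo (0 : ℝ) 1) (hδ : 0 < δ)
    {σ : Equiv.Perm (Fin N)} {c : Fin N → ℝ} (hc : AvoidsPoles N τ σ δ c)
    (ht : 0 < t) (ht1 : t ≤ 1) (y x : Fin N → ℝ) :
    Integrable (fun φ : Fin N → ℝ =>
      betheIntegrand N τ σ y x t (fun j => lineZ (c j) (φ j))) := by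
  have hK : ∀ j, |c j| ≤ 1 + ∑ i, |c i| := fun j => by
    linarith [Finset.single_le_sum (fun i _ => abs_nonneg (c i)) (Finset.mem_univ j)]
  have hK1 : 1 ≤ 1 + ∑ i, |c i| := by
    linarith [Finset.sum_nonneg fun i (_ : i ∈ Finset.univ) => abs_nonneg (c i)]
  refine ((integrable_prod_exp_neg_mul_sq N (b := t / 4) (by positivity)).const_mul _).mono' ?_
    (.of_forall fun φ => norm_betheIntegrand_le hτ hδ hc hK1 hK ht ht1 y x φ)
  have hm := measurable_betheIntegrand N τ σ y t
  exact (hm.comp (g := fun p : (Fin N → ℝ) × (Fin N → ℂ) => betheIntegrand N τ σ y p.1 t p.2)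
    (f := fun φ : Fin N → ℝ => (x, fun j => lineZ (c j) (φ j)))
    (by unfold lineZ; fun_prop)).aestronglyMeasurable

theorem differentiableAt_betheIntegrand_update {N : ℕ} {τ δ t : ℝ} (hδ : 0 < δ)
    {σ : Equiv.Perm (Fin N)} (y x : Fin N → ℝ) (Z : Fin N → ℂ) (α : Fin N) (w : ℂ)
    (hc : AvoidsPoles N τ σ δ (fun j => (Function.update Z α w j).re)) :
    DifferentiableAt ℂ (fun w => betheIntegrand N τ σ y x t (Function.update Z α w)) w := by
  have hu : ∀ i, DifferentiableAt ℂ (fun w => Function.update Z α w i) w := by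
    intro i
    by_cases h : i = α
    · subst h; simp
    · simp [h]
  unfold betheIntegrand Aamp Sfac
  refine DifferentiableAt.mul ?_ ?_
  · refine DifferentiableAt.fun_finsetProd fun pr hpr => ?_
    have hpr' := (Finset.mem_filter.1 hpr).2
    refine (DifferentiableAt.div (((hu _).const_mul _).sub (hu _))
      (((hu _).const_mul _).sub (hu _)) fun h0 => ?_).neg
    have h1 := hc _ _ hpr'.1 hpr'.2
    have h2 := congrArg Complex.re h0
    rw [Pi.sub_apply, Complex.sub_re, Complex.re_ofReal_mul, Complex.zero_re] at h2
    linarith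
  · refine DifferentiableAt.fun_finsetProd fun j _ => ?_
    exact ((hu _).mul_const _).cexp.mul ((((hu _).pow 2).mul_const _).div_const _).cexp

/-- Moving the contour of one variable `z_α` from `Γ_a` to `Γ_s` across a pole-free strip. -/
theorem integral_betheIntegrand_shift {N : ℕ} {τ δ a s t : ℝ} (hτ : τ ∈ Ioo (0 : ℝ) 1)
    (hδ : 0 < δ) {σ : Equiv.Perm (Fin N)} (α : Fin N)
    (hc : ∀ r ∈ uIcc a s, AvoidsPoles N τ σ δ (Function.update (fun _ => a) α r))
    (ht : 0 < t) (ht1 : t ≤ 1) (y x : Fin N → ℝ) :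
    ∫ φ : Fin N → ℝ, betheIntegrand N τ σ y x t (fun j => lineZ a (φ j)) =
      ∫ φ : Fin N → ℝ, betheIntegrand N τ σ y x t
        (fun j => lineZ (Function.update (fun _ => a) α s j) (φ j)) := by
  have hint := fun r hr => integrable_betheIntegrand hτ hδ (hc r hr) ht ht1 y x
  have ha : Function.update (fun _ : Fin N => a) α a = fun _ => a := Function.update_eq_self α _
  refine integral_eq_of_integral_update_eq α (by simpa [ha] using hint a left_mem_uIcc)
    (hint s right_mem_uIcc) fun φ => ?_
  have hline : ∀ r u : ℝ, (fun j => lineZ (Function.update (fun _ => a) α r j)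
      (Function.update φ α u j)) =
      Function.update (fun j => lineZ a (φ j)) α (lineZ r u) := by
    intro r u
    ext j
    by_cases h : j = α
    · subst h; simp
    · simp [h]
  have hline' := hline a
  simp only [ha] at hline'
  simp only [hline, hline']
  set K : ℝ := 1 + |a| + |s| with hK
  have hKr : ∀ r ∈ uIcc a s, ∀ j, |Function.update (fun _ : Fin N => a) α r j| ≤ K := by
    intro r hr j
    have : |r| ≤ |a| + |s| := by
      rcases mem_uIcc.1 hr with h | h <;>
        exact abs_le.2 ⟨by linarith [neg_abs_le a, neg_abs_le s, abs_nonneg a, abs_nonneg s],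
          by linarith [le_abs_self a, le_abs_self s, abs_nonneg a, abs_nonneg s]⟩
    by_cases h : j = α
    · subst h; simp only [Function.update_self]; linarith
    · simp only [Function.update_of_ne h]; linarith [abs_nonneg s]
  refine integral_lineZ_eq_of_gaussian_bound_s6
    (h := fun w => betheIntegrand N τ σ y x t (Function.update (fun j => lineZ a (φ j)) α w))
    (b := t / 4)
    (C := (2 * K / δ) ^ numInv σ *
        ((numInv σ).factorial * Real.exp 2 * (1 / t) ^ numInv σ) ^ N *
        Real.exp (∑ j, K * |x j - y (σ j)| + t / 2 * ∑ _j : Fin N, K ^ 2))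
    (by positivity) (fun z hz => ?_) (fun r hr u => ?_)
  · refine differentiableAt_betheIntegrand_update hδ y x _ α z ?_
    convert hc _ hz using 2 with j
    by_cases h : j = α
    · subst h; simp
    · simp [h, lineZ]
  · have hb := norm_betheIntegrand_le hτ hδ (hc r hr) (K := K)
      (by linarith [abs_nonneg a, abs_nonneg s]) (hKr r hr) ht ht1 y x (Function.update φ α u)
    rw [hline] at hb
    refine hb.trans ?_
    have hK0 : 0 ≤ K := by positivity
    refine mul_le_mul (mul_le_mul_of_nonneg_left (Real.exp_le_exp.2 (add_le_add
      (Finset.sum_le_sum fun j _ => ?_) (mul_le_mul_of_nonneg_left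
        (Finset.sum_le_sum fun j _ => ?_) (by positivity)))) (by positivity)) ?_
      (by positivity) (by positivity)
    · refine (le_abs_self _).trans ?_
      rw [abs_mul]
      exact mul_le_mul_of_nonneg_right (hKr r hr _) (abs_nonneg _)
    · rw [← sq_abs]
      exact pow_le_pow_left₀ (abs_nonneg _) (hKr r hr _) 2
    · rw [← Finset.mul_prod_erase _ _ (Finset.mem_univ α), Function.update_self]
      refine mul_le_of_le_one_right (Real.exp_pos _).le ?_
      refine Finset.prod_le_one (fun _ _ => (Real.exp_pos _).le) fun j _ => ?_
      rw [Real.exp_le_one_iff]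
      nlinarith [sq_nonneg (Function.update φ α u j)]

theorem WeylPlusEps.add_le {N : ℕ} {ε : ℝ} {x : Fin N → ℝ} (hx : x ∈ WeylPlusEps N ε)
    {i j : Fin N} (hij : i < j) : x i + ε ≤ x j := by
  have hi : (i : ℕ) + 1 < N := lt_of_le_of_lt hij j.2
  have h1 := hx.2 i hi
  have h2 : x ⟨(i : ℕ) + 1, hi⟩ ≤ x j := hx.1 (show (i : ℕ) + 1 ≤ j from hij)
  linarith

/-- For `σ ≠ 1` some contour can be moved arbitrarily far, without meeting a pole, in a direction
`η` in which its exponential factor decays. -/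
theorem exists_escape_direction {N : ℕ} {τ a ε : ℝ} (hτ : τ ∈ Ioo (0 : ℝ) 1)
    {σ : Equiv.Perm (Fin N)} (hσ : σ ≠ 1) {x y : Fin N → ℝ}
    (hx : x ∈ WeylPlusEps N ε) (hy : y ∈ WeylPlus N) :
    ∃ (α : Fin N) (η : ℝ), η ^ 2 = 1 ∧ η * (x (σ.symm α) - y α) ≤ -(ε / 2) ∧
      ∀ r, 0 ≤ r →
        AvoidsPoles N τ σ ((1 - τ) * a) (Function.update (fun _ => a) α (a + η * r)) := by
  have hne : ∃ k, σ k ≠ k := by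
    by_contra! h
    exact hσ (Equiv.ext h)
  obtain ⟨k, hk, hmin⟩ : ∃ k, σ k ≠ k ∧ ∀ i < k, σ i = i := by
    refine ⟨Fin.find _ hne, Fin.find_spec hne, fun i hi => ?_⟩
    simpa using Fin.find_min hne hi
  have hlt : ∀ i, k < σ i → k ≤ i := fun i hi => by
    by_contra! h
    rw [hmin i h] at hi
    exact lt_asymm h hi
  have hge : ∀ i, k ≤ i → k ≤ σ i := fun i hi => by
    by_contra! h
    have := σ.injective (hmin _ h)
    rw [this] at h
    exact absurd hi (not_le.2 h)
  have hσk : k < σ k := lt_of_le_of_ne (hge k le_rfl) (Ne.symm hk)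
  have hsymm : k < σ.symm k := by
    refine lt_of_le_of_ne ?_ fun h => hk ?_
    · by_contra! h
      have := hmin _ h
      rw [Equiv.apply_symm_apply] at this
      exact absurd h (by rw [← this]; exact lt_irrefl _)
    · conv_lhs => rw [h]
      exact Equiv.apply_symm_apply σ k
  have hτ1 := hτ.2
  have hτ0 := hτ.1
  by_cases hcase : ε / 2 ≤ x (σ.symm k) - y k
  · refine ⟨k, -1, by norm_num, by linarith, fun r hr i j hij hinv => ?_⟩
    have h1 : σ i ≠ k := fun h => by
      have hi : i = σ.symm k := by rw [← h, Equiv.symm_apply_apply]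
      have : k ≤ σ j := hge j ((hsymm.trans_eq hi.symm).trans hij).le
      rw [h] at hinv
      exact absurd hinv (not_lt.2 this)
    rw [Function.update_of_ne h1, Function.update_apply]
    split_ifs
    · nlinarith [mul_nonneg hτ0.le hr]
    · linarith
  · refine ⟨σ k, 1, by norm_num, ?_, fun r hr i j hij hinv => ?_⟩
    · have h1 := WeylPlusEps.add_le hx hsymm
      have h2 : y k ≤ y (σ k) := hy hσk.le
      rw [Equiv.symm_apply_apply]
      linarith
    · have h1 : σ j ≠ σ k := fun h => by
        have hj := σ.injective h
        subst hj
        rw [hmin i hij] at hinv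
        exact lt_asymm hij (hσk.trans hinv)
      rw [Function.update_of_ne h1, Function.update_apply]
      split_ifs <;> linarith

/-- For `σ ≠ 1`, `Iperm` is exponentially small in `1/t`, uniformly over compact subsets of
`WeylPlusEps N ε`. -/
theorem exists_norm_Iperm_le {N : ℕ} {τ a ε : ℝ} (hτ : τ ∈ Ioo (0 : ℝ) 1) (ha : 0 < a)
    (hε : 0 < ε) {σ : Equiv.Perm (Fin N)} (hσ : σ ≠ 1) {y : Fin N → ℝ} (hy : y ∈ WeylPlus N)
    {k : Set (Fin N → ℝ)} (hk : IsCompact k) (hkε : k ⊆ WeylPlusEps N ε) :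
    ∃ (C : ℝ) (M : ℕ), ∀ t ∈ Ioc (0 : ℝ) 1, ∀ x ∈ k,
      ‖Iperm N τ a σ y x t‖ ≤ C * ((1 / t) ^ M * Real.exp (-(ε ^ 2 / 16) * (1 / t))) := by
  obtain ⟨B, hB⟩ := hk.exists_bound_of_continuousOn
    (f := fun x : Fin N → ℝ => ∑ j, a * (x j - y (σ j))) (by fun_prop)
  set δ : ℝ := (1 - τ) * a
  have hδ : 0 < δ := mul_pos (by linarith [hτ.2]) ha
  set m := numInv σ
  refine ⟨(2 * (a + 1 + ε) / δ) ^ m * (m.factorial * Real.exp 2) ^ N * Real.exp (B + N * a ^ 2) *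
    (4 * Real.pi) ^ N, m + m * N + N, fun t ⟨ht, ht1⟩ x hx => ?_⟩
  obtain ⟨α, η, hη, hdir, havoid⟩ := exists_escape_direction (a := a) hτ hσ (hkε hx) hy
  set R : ℝ := ε / (4 * t) with hR
  have hR0 : 0 < R := by positivity
  have hη1 : η = 1 ∨ η = -1 := sq_eq_one_iff.1 hη
  set c : Fin N → ℝ := Function.update (fun _ => a) α (a + η * R) with hcdef
  have hseg : ∀ r ∈ uIcc a (a + η * R),
      AvoidsPoles N τ σ δ (Function.update (fun _ => a) α r) := by
    intro r hr
    have hr0 : 0 ≤ η * (r - a) := by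
      rcases hη1 with rfl | rfl
      · rw [uIcc_of_le (by linarith)] at hr
        linarith [hr.1]
      · rw [uIcc_of_ge (by linarith)] at hr
        linarith [hr.2]
    have h1 := havoid _ hr0
    rwa [← mul_assoc, ← sq, hη, one_mul, add_sub_cancel] at h1
  have hcj : ∀ j, c j = a + if j = α then η * R else 0 := by
    intro j
    rw [hcdef, Function.update_apply]
    split_ifs <;> simp
  have hK1 : 1 ≤ a + 1 + R := by linarith
  have hK : ∀ j, |c j| ≤ a + 1 + R := by
    intro j
    rw [hcj]
    split_ifs
    · rcases hη1 with rfl | rfl <;> exact abs_le.2 ⟨by linarith, by linarith⟩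
    · exact abs_le.2 ⟨by linarith, by linarith⟩
  have hbound := fun φ => norm_betheIntegrand_le hτ hδ (hseg _ right_mem_uIcc) hK1 hK ht ht1 y x φ
  have hsum1 : ∑ j, c (σ j) * (x j - y (σ j)) ≤ B - R * (ε / 2) := by
    have h1 : ∑ j, c (σ j) * (x j - y (σ j)) =
        ∑ j, a * (x j - y (σ j)) + η * R * (x (σ.symm α) - y α) := by
      simp only [hcj, add_mul, Finset.sum_add_distrib, ite_mul, zero_mul]
      congr 1
      rw [Finset.sum_eq_single (σ.symm α)]
      · simp
      · intro j _ hj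
        rw [if_neg fun h => hj (by rw [← h, Equiv.symm_apply_apply])]
      · simp
    have h2 := (le_abs_self _).trans (hB x hx)
    rw [h1]
    nlinarith [mul_le_mul_of_nonneg_left hdir hR0.le]
  have hsum2 : ∑ j, c j ^ 2 ≤ 2 * N * a ^ 2 + 2 * R ^ 2 := by
    have h1 : ∀ j, c j ^ 2 ≤ 2 * a ^ 2 + if j = α then 2 * R ^ 2 else 0 := by
      intro j
      rw [hcj]
      split_ifs
      · nlinarith [sq_nonneg (a - η * R), mul_pow η R 2]
      · nlinarith [sq_nonneg a]
    refine (Finset.sum_le_sum fun j _ => h1 j).trans_eq ?_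
    simp [Finset.sum_add_distrib]
    ring
  have hexp : ∑ j, c (σ j) * (x j - y (σ j)) + t / 2 * ∑ j, c j ^ 2 ≤
      B + N * a ^ 2 + -(ε ^ 2 / 16) * (1 / t) := by
    have h1 : t / 2 * ∑ j, c j ^ 2 ≤ N * a ^ 2 + t * R ^ 2 := by
      have h2 := mul_le_mul_of_nonneg_left hsum2 (by positivity : 0 ≤ t / 2)
      have h3 : t * (N * a ^ 2) ≤ 1 * (N * a ^ 2) := by gcongr
      linarith
    have h2 : t * R ^ 2 - R * (ε / 2) = -(ε ^ 2 / 16) * (1 / t) := by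
      rw [hR]
      field_simp
      ring
    linarith
  have hKt : a + 1 + R ≤ (a + 1 + ε) * (1 / t) := by
    have h1 : 1 ≤ 1 / t := by rw [le_div_iff₀ ht]; linarith
    have h2 : R = ε / 4 * (1 / t) := by rw [hR]; field_simp
    nlinarith
  have hgauss : ∫ φ : Fin N → ℝ, ∏ j, Real.exp (-(t / 4) * φ j ^ 2) ≤ (4 * Real.pi * (1 / t)) ^ N := by
    rw [integral_fintype_prod_volume_eq_prod (fun (_ : Fin N) u => Real.exp (-(t / 4) * u ^ 2)),
      Finset.prod_const, Finset.card_univ, Fintype.card_fin, integral_gaussian]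
    have h1 : Real.pi / (t / 4) = 4 * Real.pi * (1 / t) := by field_simp
    have h2 : 1 ≤ 4 * Real.pi * (1 / t) := by
      have h3 : 1 ≤ 1 / t := by rw [le_div_iff₀ ht]; linarith
      nlinarith [Real.pi_gt_three]
    rw [h1]
    gcongr
    exact Real.sqrt_le_self_iff.2 (.inr h2)
  have hpref : ‖(1 / (2 * Real.pi) : ℂ) ^ N‖ ≤ 1 := by
    rw [norm_pow]
    refine pow_le_one₀ (norm_nonneg _) ?_
    rw [norm_div, norm_mul, Complex.norm_real, Real.norm_of_nonneg Real.pi_pos.le]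
    simp only [norm_one, Complex.norm_ofNat]
    rw [div_le_one (by positivity)]
    linarith [Real.pi_gt_three]
  have hshift := integral_betheIntegrand_shift hτ hδ α hseg ht ht1 y x
  calc ‖Iperm N τ a σ y x t‖
      = ‖(1 / (2 * Real.pi) : ℂ) ^ N‖ * ‖∫ φ : Fin N → ℝ, betheIntegrand N τ σ y x t
          (fun j => lineZ (c j) (φ j))‖ := by
        rw [← hshift, ← norm_mul]
        rfl
    _ ≤ 1 * ‖∫ φ : Fin N → ℝ, betheIntegrand N τ σ y x t (fun j => lineZ (c j) (φ j))‖ := by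
        gcongr
    _ ≤ ∫ φ : Fin N → ℝ, (2 * (a + 1 + R) / δ) ^ m *
          (m.factorial * Real.exp 2 * (1 / t) ^ m) ^ N *
          Real.exp (∑ j, c (σ j) * (x j - y (σ j)) + t / 2 * ∑ j, c j ^ 2) *
          ∏ j, Real.exp (-(t / 4) * φ j ^ 2) := by
        exact (one_mul _).trans_le <| norm_integral_le_of_norm_le
          ((integrable_prod_exp_neg_mul_sq N (b := t / 4) (by positivity)).const_mul _)
          (.of_forall hbound)
    _ ≤ (2 * ((a + 1 + ε) * (1 / t)) / δ) ^ m * (m.factorial * Real.exp 2 * (1 / t) ^ m) ^ N *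
        Real.exp (B + N * a ^ 2 + -(ε ^ 2 / 16) * (1 / t)) * (4 * Real.pi * (1 / t)) ^ N := by
        rw [integral_const_mul]
        gcongr
    _ = _ := by
        rw [Real.exp_add]
        simp only [div_pow, mul_pow, pow_add, pow_mul]
        ring

theorem tendsto_inv_pow_mul_exp_nhdsGT_zero (C : ℝ) (M : ℕ) {κ : ℝ} (hκ : 0 < κ) :
    Tendsto (fun t : ℝ => C * ((1 / t) ^ M * Real.exp (-κ * (1 / t)))) (nhdsWithin 0 (Ioi 0))
      (nhds 0) := by
  have h := (tendsto_rpow_mul_exp_neg_mul_atTop_nhds_zero M κ hκ).comp tendsto_inv_nhdsGT_zero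
  simpa using h.const_mul C

theorem stronglyMeasurable_Iperm (N : ℕ) (τ a : ℝ) (σ : Equiv.Perm (Fin N)) (y : Fin N → ℝ)
    (t : ℝ) : StronglyMeasurable (fun x : Fin N → ℝ => Iperm N τ a σ y x t) := by
  refine StronglyMeasurable.const_mul (StronglyMeasurable.integral_prod_right ?_) _
  refine Measurable.stronglyMeasurable ?_
  exact (measurable_betheIntegrand N τ σ y t).comp
    (f := fun p : (Fin N → ℝ) × (Fin N → ℝ) => (p.1, fun j => lineZ a (p.2 j)))
    (by unfold lineZ; fun_prop)

/-- The heat kernel on `ℝ`. -/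
noncomputable def heatKer (t u : ℝ) : ℝ := (√(2 * Real.pi * t))⁻¹ * Real.exp (-u ^ 2 / (2 * t))

theorem integral_lineZ_gaussian (a u : ℝ) {t : ℝ} (ht : 0 < t) :
    ∫ φ : ℝ, Complex.exp (lineZ a φ * u) * Complex.exp (lineZ a φ ^ 2 * (t : ℂ) / 2) =
      (2 * Real.pi : ℝ) * (heatKer t u : ℝ) := by
  have ht0 : (t : ℂ) ≠ 0 := by exact_mod_cast ht.ne'
  have h1 := integral_cexp_quadratic (b := ((-(t / 2) : ℝ) : ℂ))
    (by rw [Complex.ofReal_re]; linarith) (Complex.I * (u + a * t)) (a * u + a ^ 2 * t / 2)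
  have h2 : ((a * u + a ^ 2 * t / 2 : ℂ) - (Complex.I * (u + a * t)) ^ 2 /
      (4 * ((-(t / 2) : ℝ) : ℂ))) = ((-u ^ 2 / (2 * t) : ℝ) : ℂ) := by
    rw [mul_pow, Complex.I_sq]
    push_cast
    field_simp
    ring
  have h3 : ((Real.pi : ℂ) / -((-(t / 2) : ℝ) : ℂ)) ^ (1 / 2 : ℂ) =
      ((2 * Real.pi * (√(2 * Real.pi * t))⁻¹ : ℝ) : ℂ) := by
    have h4 : ((Real.pi : ℂ) / -((-(t / 2) : ℝ) : ℂ)) = ((2 * Real.pi / t : ℝ) : ℂ) := by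
      push_cast
      field_simp
    rw [h4, show (1 / 2 : ℂ) = ((1 / 2 : ℝ) : ℂ) by push_cast; rfl,
      ← Complex.ofReal_cpow (by positivity), ← Real.sqrt_eq_rpow]
    congr 1
    rw [eq_mul_inv_iff_mul_eq₀ (by positivity), ← Real.sqrt_mul (by positivity)]
    rw [show 2 * Real.pi / t * (2 * Real.pi * t) = (2 * Real.pi) ^ 2 by field_simp]
    exact Real.sqrt_sq (by positivity)
  rw [h2, h3] at h1
  rw [heatKer, ← Complex.ofReal_mul, ← mul_assoc, Complex.ofReal_mul, Complex.ofReal_exp, ← h1]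
  congr 1
  ext φ
  rw [← Complex.exp_add]
  congr 1
  unfold lineZ
  push_cast
  ring_nf
  rw [Complex.I_sq]
  ring

/-- For the identity permutation `Iperm` is a product of heat kernels. -/
theorem Iperm_one (N : ℕ) (τ a : ℝ) (y x : Fin N → ℝ) {t : ℝ} (ht : 0 < t) :
    Iperm N τ a 1 y x t = ((∏ j, heatKer t (x j - y j) : ℝ) : ℂ) := by
  have hA : ∀ z, Aamp N τ 1 z = 1 := fun z => by
    unfold Aamp
    rw [Finset.filter_false_of_mem, Finset.prod_empty]
    exact fun pr _ h => lt_asymm h.1 h.2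
  have hprod := integral_fintype_prod_volume_eq_prod (fun (j : Fin N) (φ : ℝ) =>
    Complex.exp (lineZ a φ * ((x j - y j : ℝ) : ℂ)) * Complex.exp (lineZ a φ ^ 2 * (t : ℂ) / 2))
  simp only [integral_lineZ_gaussian a _ ht] at hprod
  simp only [Complex.ofReal_sub] at hprod
  simp only [Iperm, hA, one_mul, Equiv.Perm.coe_one, id_eq]
  rw [hprod, Finset.prod_mul_distrib, Finset.prod_const, Finset.card_univ, Fintype.card_fin,
    ← mul_assoc, ← mul_pow, Complex.ofReal_prod]
  have hpi : (Real.pi : ℂ) ≠ 0 := by exact_mod_cast Real.pi_ne_zero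
  rw [show (1 / (2 * Real.pi) * ((2 * Real.pi : ℝ) : ℂ)) = 1 by push_cast; field_simp, one_pow,
    one_mul]

theorem continuous_heatKer (t : ℝ) : Continuous (heatKer t) := by
  unfold heatKer
  fun_prop

theorem integrable_prod_heatKer_one (N : ℕ) :
    Integrable (fun s : Fin N → ℝ => ∏ j, heatKer 1 (s j)) := by
  refine Integrable.fintype_prod (f := fun (_ : Fin N) u => heatKer 1 u) fun _ => ?_
  refine ((integrable_exp_neg_mul_sq (b := 1 / 2) (by norm_num)).const_mul
    (√(2 * Real.pi * 1))⁻¹).congr (.of_forall fun u => ?_)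
  simp only [heatKer]
  ring_nf

theorem integral_prod_heatKer_one (N : ℕ) : ∫ s : Fin N → ℝ, ∏ j, heatKer 1 (s j) = 1 := by
  rw [integral_fintype_prod_volume_eq_prod (fun (_ : Fin N) u => heatKer 1 u)]
  refine Finset.prod_eq_one fun _ _ => ?_
  have h : heatKer 1 = fun u => (√(2 * Real.pi * 1))⁻¹ * Real.exp (-(1 / 2) * u ^ 2) := by
    ext u
    simp only [heatKer]
    ring_nf
  rw [h, integral_const_mul, integral_gaussian,
    show Real.pi / (1 / 2) = 2 * Real.pi * 1 by ring]
  exact inv_mul_cancel₀ (by positivity)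

theorem heatKer_sqrt_mul {t : ℝ} (ht : 0 < t) (u : ℝ) :
    heatKer t (√t * u) = (√t)⁻¹ * heatKer 1 u := by
  have h : -(√t * u) ^ 2 / (2 * t) = -u ^ 2 / (2 * 1) := by
    rw [mul_pow, Real.sq_sqrt ht.le]
    field_simp
  rw [heatKer, heatKer, h, Real.sqrt_mul (by positivity) t, mul_one, mul_inv]
  ring_nf

/-- Products of heat kernels form an approximate identity on `ℝ^N`. -/
theorem tendsto_integral_mul_prod_heatKer {N : ℕ} {f : (Fin N → ℝ) → ℝ} (hf : Continuous f)
    (hfc : HasCompactSupport f) (y : Fin N → ℝ) :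
    Tendsto (fun t : ℝ => ∫ x, f x * ∏ j, heatKer t (x j - y j)) (nhdsWithin 0 (Ioi 0))
      (nhds (f y)) := by
  obtain ⟨C, hC⟩ := hfc.exists_bound_of_continuous hf
  have hscale : ∀ t ∈ Ioi (0 : ℝ), ∫ s : Fin N → ℝ, f (√t • s + y) * ∏ j, heatKer 1 (s j) =
      ∫ x, f x * ∏ j, heatKer t (x j - y j) := by
    intro t ht
    have ht' : 0 < t := ht
    rw [← integral_add_right_eq_self (fun x => f x * ∏ j, heatKer t (x j - y j)) y]
    have h1 := Measure.integral_comp_smul_of_nonneg (volume : Measure (Fin N → ℝ))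
      (fun s => f (s + y) * ∏ j, heatKer t ((s + y) j - y j)) (√t) (hR := Real.sqrt_nonneg t)
    rw [Module.finrank_fin_fun, eq_inv_smul_iff₀ (by positivity), ← integral_smul] at h1
    rw [← h1]
    congr 1
    ext s
    simp only [Pi.add_apply, Pi.smul_apply, smul_eq_mul, add_sub_cancel_right,
      heatKer_sqrt_mul ht', Finset.prod_mul_distrib, Finset.prod_const, Finset.card_univ,
      Fintype.card_fin]
    rw [mul_left_comm, ← mul_assoc (√t ^ N), ← mul_pow, mul_inv_cancel₀ (by positivity), one_pow,
      one_mul]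
  refine Tendsto.congr' (eventually_nhdsWithin_of_forall hscale) ?_
  have hcont : Continuous fun s : Fin N → ℝ => ∏ j, heatKer 1 (s j) :=
    continuous_finsetProd _ fun j _ => (continuous_heatKer 1).comp (continuous_apply j)
  have hlim : f y = ∫ s : Fin N → ℝ, f y * ∏ j, heatKer 1 (s j) := by
    rw [integral_const_mul, integral_prod_heatKer_one, mul_one]
  rw [hlim]
  refine tendsto_integral_filter_of_dominated_convergence
    (fun s => C * ∏ j, heatKer 1 (s j)) (.of_forall fun t => ?_) (.of_forall fun t => ?_)
    ((integrable_prod_heatKer_one N).const_mul C) (.of_forall fun s => ?_)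
  · exact Continuous.aestronglyMeasurable (by fun_prop)
  · refine .of_forall fun s => ?_
    have h0 : 0 ≤ ∏ j, heatKer 1 (s j) :=
      Finset.prod_nonneg fun j _ => by unfold heatKer; positivity
    rw [norm_mul, Real.norm_of_nonneg h0]
    exact mul_le_mul_of_nonneg_right (hC _) h0
  · refine Tendsto.mul_const _ ?_
    have h1 : Continuous fun t : ℝ => f (√t • s + y) := by fun_prop
    have h2 := (h1.tendsto 0).mono_left (nhdsWithin_le_nhds (s := Ioi 0))
    simpa using h2

/-- The limit of the contribution of each permutation, together with its integrability. -/
theorem Iperm_initial {N : ℕ} {τ a ε : ℝ} (hτ : τ ∈ Ioo (0 : ℝ) 1) (ha : 0 < a) (hε : 0 < ε)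
    {f : (Fin N → ℝ) → ℝ} (hf : Continuous f) (hfc : HasCompactSupport f)
    (hsupp : tsupport f ⊆ WeylPlusEps N ε) {y : Fin N → ℝ} (hy : y ∈ WeylPlus N)
    (σ : Equiv.Perm (Fin N)) :
    (∀ t ∈ Ioc (0 : ℝ) 1, Integrable fun x => (f x : ℂ) * Iperm N τ a σ y x t) ∧
      Tendsto (fun t : ℝ => ∫ x, (f x : ℂ) * Iperm N τ a σ y x t) (nhdsWithin 0 (Ioi 0))
        (nhds (if σ = 1 then (f y : ℂ) else 0)) := by
  by_cases hσ : σ = 1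
  · subst hσ
    have heq : ∀ t : ℝ, 0 < t → (fun x => (f x : ℂ) * Iperm N τ a 1 y x t) =
        fun x => ((f x * ∏ j, heatKer t (x j - y j) : ℝ) : ℂ) := fun t ht => by
      ext x
      rw [Iperm_one N τ a y x ht, Complex.ofReal_mul]
    constructor
    · intro t ht
      rw [heq t ht.1]
      have hcont : Continuous fun x : Fin N → ℝ => ∏ j, heatKer t (x j - y j) :=
        continuous_finsetProd _ fun j _ => (continuous_heatKer t).comp (by fun_prop)
      exact ((hf.mul hcont).integrable_of_hasCompactSupport hfc.mul_right).ofReal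
    · rw [if_pos rfl]
      refine Tendsto.congr' (eventually_nhdsWithin_of_forall fun t ht => ?_)
        ((Complex.continuous_ofReal.tendsto _).comp (tendsto_integral_mul_prod_heatKer hf hfc y))
      simp only [Function.comp_apply, heq t ht, integral_complex_ofReal]
  · obtain ⟨C, M, hC⟩ := exists_norm_Iperm_le (a := a) hτ ha hε hσ hy hfc hsupp
    have hfint : Integrable f := hf.integrable_of_hasCompactSupport hfc
    have hbd : ∀ t ∈ Ioc (0 : ℝ) 1, ∀ x, ‖(f x : ℂ) * Iperm N τ a σ y x t‖ ≤
        ‖f x‖ * (C * ((1 / t) ^ M * Real.exp (-(ε ^ 2 / 16) * (1 / t)))) := by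
      intro t ht x
      rw [norm_mul, Complex.norm_real]
      by_cases hx : x ∈ tsupport f
      · exact mul_le_mul_of_nonneg_left (hC t ht x hx) (norm_nonneg _)
      · simp [image_eq_zero_of_notMem_tsupport hx]
    refine ⟨fun t ht => ?_, ?_⟩
    · exact (hfint.norm.mul_const _).mono'
        ((Complex.continuous_ofReal.comp hf).aestronglyMeasurable.mul
          (stronglyMeasurable_Iperm N τ a σ y t).aestronglyMeasurable) (.of_forall (hbd t ht))
    · rw [if_neg hσ]
      have hlim := (tendsto_inv_pow_mul_exp_nhdsGT_zero C M
        (by positivity : 0 < ε ^ 2 / 16)).const_mul (∫ x, ‖f x‖)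
      rw [mul_zero] at hlim
      refine squeeze_zero_norm' ?_ hlim
      filter_upwards [Ioc_mem_nhdsGT one_pos] with t ht
      rw [← integral_mul_const]
      exact norm_integral_le_of_norm_le (hfint.norm.mul_const _) (.of_forall (hbd t ht))

/-- For a test function `f` smooth with compact support in `W_{N,ε}^+` and any `y ∈ W_N^+`,
`lim_{t→0+} ∫ f(x) Q_y(x,t) dx = f(y)`. -/
theorem Qfun_initial (N : ℕ) (hN : 1 ≤ N) (τ : ℝ) (hτ : τ ∈ Set.Ioo (0 : ℝ) 1)
    (a : ℝ) (ha : 0 < a) (ε : ℝ) (hε : 0 < ε)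
    (f : (Fin N → ℝ) → ℝ) (hf : ContDiff ℝ (⊤ : ℕ∞) f) (hfc : HasCompactSupport f)
    (hsupp : tsupport f ⊆ WeylPlusEps N ε)
    (y : Fin N → ℝ) (hy : y ∈ WeylPlus N) :
    Filter.Tendsto (fun t : ℝ => ∫ x : Fin N → ℝ, (f x : ℂ) * Qfun N τ a y x t)
      (nhdsWithin 0 (Set.Ioi 0)) (nhds (f y : ℂ)) := by
  have hI := Iperm_initial (a := a) hτ ha hε hf.continuous hfc hsupp hy
  have hlim := tendsto_finsetSum Finset.univ fun σ _ => (hI σ).2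
  rw [Finset.sum_ite_eq' Finset.univ, if_pos (Finset.mem_univ _)] at hlim
  refine Tendsto.congr' ?_ hlim
  filter_upwards [Ioc_mem_nhdsGT one_pos] with t ht
  simp only [Qfun, Finset.mul_sum]
  exact (integral_finsetSum _ fun σ _ => (hI σ).1 t ht).symm
end

section
/- Let N ≥ 1 and let p, q ∈ ℂ with p + q = 1 and q ≠ 0, and set τ = p/q. Let z₁,…,z_N ∈ ℂ be such that Σ_{j∈B} z_j ≠ 0 for every nonempty subset B ⊆ {1,…,N} and q z_j − p z_i ≠ 0 for all 1 ≤ i < j ≤ N. Then Σ_{σ∈S_N} sgn(σ) · ∏_{1≤i<j≤N} (p z_{σ(j)} − q z_{σ(i)})/(q z_j − p z_i) · ∏_{k=1}^N ( z_{σ(k)} + z_{σ(k+1)} + ⋯ + z_{σ(N)} )^{−1} = ∏_{1≤i<j≤N} (z_j − z_i)/(z_j − τ z_i) · ∏_{j=1}^N z_j^{−1}, where the sum is over all permutations σ of {1,…,N} and sgn(σ) is the sign of σ. -/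
namespace PairSuffix

open Finset Matrix Polynomial

/-- Interpolation in Vandermonde form: the signed sum of the values of a polynomial of degree at
most `n` at `n + 1` nodes, weighted by the Vandermonde minors, extracts its `n`-th coefficient. -/
theorem sum_eval_mul_det_vandermonde_succAbove {R : Type*} [CommRing R] {n : ℕ}
    (z : Fin (n + 1) → R) (g : R[X]) (hg : g.natDegree < n + 1) :
    ∑ m : Fin (n + 1), (-1) ^ (m + n : ℕ) * g.eval (z m) *
        (vandermonde (z ∘ m.succAbove)).det = g.coeff n * (vandermonde z).det := by
  have h := Matrix.det_updateCol_sum (vandermonde z) (Fin.last n) (fun i => g.coeff i)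
  rw [Matrix.det_succ_column _ (Fin.last n)] at h
  simp only [Fin.val_last, smul_eq_mul] at h
  rw [← h]
  refine Finset.sum_congr rfl fun m _ => ?_
  congr 2
  · rw [Matrix.updateCol_self, Polynomial.eval_eq_sum_range' hg, Finset.sum_range]
    rfl
  · ext i j
    simp [Matrix.vandermonde_apply]

/-- The symmetrization identity over `ℂ`, in denominator-free form. -/
theorem sum_mul_prod_sub_mul_det_vandermonde {n : ℕ} (z : Fin (n + 1) → ℂ) (t : ℂ) :
    ∑ m : Fin (n + 1), (-1) ^ (m + n : ℕ) * (z m * ∏ j, (z m - t * z (m.succAbove j))) *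
        (vandermonde (z ∘ m.succAbove)).det = (∑ j, z j) * (vandermonde z).det := by
  revert t
  rw [← funext_iff]
  refine Continuous.ext_on (dense_compl_singleton (1 : ℂ)) (by fun_prop) (by fun_prop) ?_
  intro t ht
  have ht' : 1 - t ≠ 0 := sub_ne_zero.2 (Ne.symm ht)
  set P : ℂ → ℂ[X] := fun s => ∏ j, (X - C (s * z j)) with hP
  have hmonic : ∀ s, (P s).Monic := fun s => monic_prod_X_sub_C _ _
  have hdeg : ∀ s, (P s).natDegree = n + 1 := fun s => by
    simp only [hP]
    rw [natDegree_prod_of_monic _ _ fun j _ => monic_X_sub_C _]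
    simp only [natDegree_X_sub_C, sum_const, card_univ, Fintype.card_fin, smul_eq_mul, mul_one]
  have hcoeff : ∀ s, (P s).coeff n = -∑ j, s * z j := fun s => by
    have h := prod_X_sub_C_coeff_card_pred univ (fun j => s * z j) (by simp)
    rwa [card_univ, Fintype.card_fin, Nat.add_sub_cancel] at h
  have hlt : (P t - P 1).natDegree < n + 1 := by
    have hd : (P t - P 1).degree < (P t).degree := by
      refine degree_sub_lt_left ?_ (hmonic t).ne_zero ?_
      · rw [degree_eq_natDegree (hmonic t).ne_zero, degree_eq_natDegree (hmonic 1).ne_zero,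
          hdeg, hdeg]
      · rw [(hmonic t).leadingCoeff, (hmonic 1).leadingCoeff]
    rw [degree_eq_natDegree (hmonic t).ne_zero, hdeg] at hd
    exact Nat.lt_succ_of_le (natDegree_le_iff_degree_le.2 (Order.le_of_lt_succ (by exact_mod_cast hd)))
  have key := sum_eval_mul_det_vandermonde_succAbove z (P t - P 1) hlt
  have heval : ∀ m, (P t - P 1).eval (z m) =
      (1 - t) * (z m * ∏ j, (z m - t * z (m.succAbove j))) := fun m => by
    simp only [hP, eval_sub, eval_prod, eval_X, eval_C, one_mul]
    rw [Fin.prod_univ_succAbove _ m, Fin.prod_univ_succAbove (fun j => z m - z j) m]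
    ring
  rw [coeff_sub, hcoeff, hcoeff] at key
  simp only [heval, ← Finset.mul_sum] at key
  refine mul_left_cancel₀ ht' ?_
  beta_reduce
  rw [Finset.mul_sum]
  convert key using 1
  · exact Finset.sum_congr rfl fun m _ => by ring
  · ring

theorem prod_swap_zero_succ {M : Type*} [CommMonoid M] {n : ℕ} (f : Fin (n + 1) → M)
    (m : Fin (n + 1)) :
    ∏ j : Fin n, f (Equiv.swap 0 m j.succ) = ∏ j : Fin n, f (m.succAbove j) := by
  refine Fin.cases ?_ (fun i => ?_) m
  · simp
  · simp only [← Fin.succAbove_cycleRange]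
    exact Equiv.prod_comp i.cycleRange fun j => f (i.succ.succAbove j)

theorem det_vandermonde_comp_swap_zero_succ {R : Type*} [CommRing R] {n : ℕ}
    (z : Fin (n + 1) → R) (m : Fin (n + 1)) :
    ((if m = 0 then 1 else -1 : ℤ) : R) *
        (vandermonde fun i : Fin n => z (Equiv.swap 0 m i.succ)).det =
      (-1) ^ (m : ℕ) * (vandermonde (z ∘ m.succAbove)).det := by
  refine Fin.cases ?_ (fun i => ?_) m
  · simp [Function.comp_def]
  · have h := Matrix.det_permute i.cycleRange (vandermonde (z ∘ i.succ.succAbove))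
    rw [Fin.sign_cycleRange] at h
    have hv : (vandermonde fun j : Fin n => z (Equiv.swap 0 i.succ j.succ)) =
        (vandermonde (z ∘ i.succ.succAbove)).submatrix i.cycleRange id := by
      ext a b
      simp [Matrix.vandermonde_apply, Fin.succAbove_cycleRange]
    rw [hv, h]
    simp [pow_succ]

/-- The summand of the symmetrization, as a function of the permuted variables. -/
noncomputable def pairSuffixWeight (p q : ℂ) {n : ℕ} (u : Fin n → ℂ) : ℂ :=
  (∏ i, ∏ j ∈ Ioi i, (p * u j - q * u i)) * ∏ k, (∑ l ∈ Ici k, u l)⁻¹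

theorem pairSuffixWeight_succ (p q : ℂ) {n : ℕ} (u : Fin (n + 1) → ℂ) :
    pairSuffixWeight p q u = (∏ j : Fin n, (p * u j.succ - q * u 0)) * (∑ l, u l)⁻¹ *
      pairSuffixWeight p q fun i : Fin n => u i.succ := by
  have hI : ∀ k : Fin n, ∑ l ∈ Ici k.succ, u l = ∑ l ∈ Ici k, u l.succ := fun k => by
    rw [← Fin.map_succEmb_Ici, Finset.sum_map]
    rfl
  have h0 : (Ici (0 : Fin (n + 1))) = univ := by ext; simp
  simp only [pairSuffixWeight, Fin.prod_univ_succ (n := n), Fin.prod_Ioi_zero, Fin.prod_Ioi_succ,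
    hI, h0]
  ring

theorem sum_sign_mul_pairSuffixWeight (p q : ℂ) (hq : q ≠ 0) (n : ℕ) (z : Fin n → ℂ)
    (hsum : ∀ B : Finset (Fin n), B.Nonempty → ∑ j ∈ B, z j ≠ 0) :
    ∑ σ : Equiv.Perm (Fin n), ((Equiv.Perm.sign σ : ℤ) : ℂ) *
        pairSuffixWeight p q (fun i => z (σ i)) =
      (∏ i : Fin n, ∏ _j ∈ Ioi i, q) * (vandermonde z).det * ∏ j, (z j)⁻¹ := by
  induction n with
  | zero => simp [pairSuffixWeight]
  | succ n ih =>
    have hz : ∀ m, z m ≠ 0 := fun m => by simpa using hsum {m} (by simp)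
    have hS : ∑ j, z j ≠ 0 := hsum univ univ_nonempty
    have hstep : ∀ m : Fin (n + 1), ∑ e : Equiv.Perm (Fin n),
        ((Equiv.Perm.sign (Equiv.Perm.decomposeFin.symm (m, e)) : ℤ) : ℂ) *
          pairSuffixWeight p q (fun i => z (Equiv.Perm.decomposeFin.symm (m, e) i)) =
        (∑ j, z j)⁻¹ * (∏ j, (z j)⁻¹) * (∏ i : Fin n, ∏ _j ∈ Ioi i, q) * q ^ n *
          ((-1) ^ (m + n : ℕ) * (z m * ∏ j, (z m - p / q * z (m.succAbove j))) *
            (vandermonde (z ∘ m.succAbove)).det) := by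
      intro m
      set v : Fin n → ℂ := fun i => z (Equiv.swap 0 m i.succ)
      have hvsum : ∀ B : Finset (Fin n), B.Nonempty → ∑ j ∈ B, v j ≠ 0 := fun B hB => by
        have h := hsum (B.map ((Fin.succEmb n).trans (Equiv.swap 0 m).toEmbedding)) (hB.map)
        rwa [Finset.sum_map] at h
      have hinv : ∏ j, (v j)⁻¹ = z m * ∏ j, (z j)⁻¹ := by
        rw [prod_swap_zero_succ (fun x => (z x)⁻¹) m, Fin.prod_univ_succAbove _ m,
          mul_inv_cancel_left₀ (hz m)]
      have hfac : ∏ j : Fin n, (p * v j - q * z m) =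
          (-1) ^ n * q ^ n * ∏ j, (z m - p / q * z (m.succAbove j)) := by
        rw [prod_swap_zero_succ (fun x => p * z x - q * z m) m]
        have hc : ∀ j : Fin n, p * z (m.succAbove j) - q * z m =
            (-1 * q) * (z m - p / q * z (m.succAbove j)) := fun j => by
          field_simp
          ring
        simp only [hc, Finset.prod_mul_distrib, prod_const, card_univ, Fintype.card_fin]
      have hterm : ∀ e : Equiv.Perm (Fin n),
          ((Equiv.Perm.sign (Equiv.Perm.decomposeFin.symm (m, e)) : ℤ) : ℂ) *
            pairSuffixWeight p q (fun i => z (Equiv.Perm.decomposeFin.symm (m, e) i)) =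
          (((if m = 0 then 1 else -1 : ℤ) : ℂ) * (∏ j : Fin n, (p * v j - q * z m)) *
            (∑ j, z j)⁻¹) * (((Equiv.Perm.sign e : ℤ) : ℂ) *
              pairSuffixWeight p q fun i => v (e i)) := fun e => by
        rw [pairSuffixWeight_succ, Equiv.sum_comp _ z, Equiv.Perm.decomposeFin.symm_sign]
        simp only [Equiv.Perm.decomposeFin_symm_apply_zero,
          Equiv.Perm.decomposeFin_symm_apply_succ]
        rw [Equiv.prod_comp e fun j => p * z (Equiv.swap 0 m j.succ) - q * z m]
        split_ifs <;> push_cast <;> ring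
      simp only [hterm]
      rw [← Finset.mul_sum, ih v hvsum, hinv, hfac]
      linear_combination ((-1) ^ n * q ^ n * (∏ j, (z m - p / q * z (m.succAbove j))) *
        (∑ j, z j)⁻¹ * (∏ i : Fin n, ∏ _j ∈ Ioi i, q) * (z m * ∏ j, (z j)⁻¹)) *
          det_vandermonde_comp_swap_zero_succ z m
    have hQ : ∏ i : Fin (n + 1), ∏ _j ∈ Ioi i, q = q ^ n * ∏ i : Fin n, ∏ _j ∈ Ioi i, q := by
      rw [Fin.prod_univ_succ, Fin.prod_Ioi_zero]
      simp_rw [Fin.prod_Ioi_succ]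
      rw [prod_const, card_univ, Fintype.card_fin]
    rw [← Equiv.Perm.decomposeFin.symm.sum_comp, Fintype.sum_prod_type]
    simp only [hstep]
    rw [← Finset.mul_sum, sum_mul_prod_sub_mul_det_vandermonde, hQ]
    field_simp

theorem prod_filter_fst_lt_snd {M : Type*} [CommMonoid M] {n : ℕ} (f : Fin n × Fin n → M) :
    ∏ pr ∈ Finset.univ.filter (fun pr : Fin n × Fin n => pr.1 < pr.2), f pr =
      ∏ i, ∏ j ∈ Ioi i, f (i, j) := by
  rw [Finset.prod_filter, Fintype.prod_prod_type]
  refine Finset.prod_congr rfl fun i _ => ?_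
  rw [← Finset.prod_filter, Finset.filter_lt_eq_Ioi]

end PairSuffix

/-- The combinatorial identity of Tracy and Widom used for the distribution function:
`Σ_σ sgn(σ) ∏_{i<j} (p z_{σ(j)} − q z_{σ(i)})/(q z_j − p z_i) ·
∏_k (z_{σ(k)} + ⋯ + z_{σ(N)})⁻¹ = ∏_{i<j} (z_j − z_i)/(z_j − τ z_i) · ∏_j z_j⁻¹`
with `τ = p/q`. -/
theorem combinatorial_identity (N : ℕ) (hN : 1 ≤ N) (p q : ℂ)
    (hpq : p + q = 1) (hq : q ≠ 0)
    (z : Fin N → ℂ)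
    (hsum : ∀ B : Finset (Fin N), B.Nonempty → ∑ j ∈ B, z j ≠ 0)
    (hden : ∀ i j : Fin N, i < j → q * z j - p * z i ≠ 0) :
    ∑ σ : Equiv.Perm (Fin N),
      ((Equiv.Perm.sign σ : ℤ) : ℂ) *
        (∏ pr ∈ Finset.univ.filter (fun pr : Fin N × Fin N => pr.1 < pr.2),
          ((p * z (σ pr.2) - q * z (σ pr.1)) / (q * z pr.2 - p * z pr.1))) *
        ∏ k : Fin N,
          (∑ l ∈ Finset.univ.filter (fun l : Fin N => k ≤ l), z (σ l))⁻¹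
    = (∏ pr ∈ Finset.univ.filter (fun pr : Fin N × Fin N => pr.1 < pr.2),
        ((z pr.2 - z pr.1) / (z pr.2 - p / q * z pr.1))) *
      ∏ j : Fin N, (z j)⁻¹ := by
  have hIci : ∀ k : Fin N, Finset.univ.filter (fun l : Fin N => k ≤ l) = Finset.Ici k :=
    fun k => Finset.filter_le_eq_Ici
  have key := PairSuffix.sum_sign_mul_pairSuffixWeight p q hq N z hsum
  simp only [PairSuffix.pairSuffixWeight, Matrix.det_vandermonde] at key
  have hR : ∀ i j : Fin N, (z j - z i) / (z j - p / q * z i) =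
      q * (z j - z i) / (q * z j - p * z i) := fun i j => by
    rw [← mul_div_mul_left _ _ hq]
    congr 1
    field_simp
  simp only [PairSuffix.prod_filter_fst_lt_snd, hIci, hR, Finset.prod_div_distrib, Finset.prod_mul_distrib]
  rw [div_mul_eq_mul_div, ← key, Finset.sum_div]
  exact Finset.sum_congr rfl fun σ _ => by ring
end

section
/- Fix N ≥ 1, a > 0 and t > 0, and for m ∈ ℤ and u ∈ ℝ define F_m(u) = (1/(2π)) ∫_ℝ (a+iφ)^m e^{(a+iφ)u} e^{(a+iφ)² t/2} dφ (an absolutely convergent integral; for negative m, (a+iφ)^m is the integer power, well defined since a > 0). Then for all x, y ∈ ℝ^N: Σ_{σ∈S_N} ∫_{Γ_a} dz₁ ⋯ ∫_{Γ_a} dz_N ∏_{(α,β)∈In(σ)} (−z_β/z_α) · ∏_{j=1}^N e^{z_{σ(j)}(x_j − y_{σ(j)})} e^{z_j² t/2} = det( F_{i−j}(x_i − y_j) )_{i,j=1}^N. The left-hand side is the Bethe-ansatz transition density at τ = 0 (totally asymmetric case q = 1), since S(z_α,z_β) = −(τ z_α − z_β)/(τ z_β − z_α) equals −z_β/z_α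 at τ = 0. -/
open MeasureTheory

/-- `F_m(u) = (1/(2πi)) ∫_{Γ_a} z^m e^{zu} e^{z² t/2} dz`, with `m ∈ ℤ`. -/
noncomputable def Fm (a t : ℝ) (m : ℤ) (u : ℝ) : ℂ :=
  (1 / (2 * Real.pi) : ℂ) *
    ∫ φ : ℝ, (lineZ a φ) ^ m * Complex.exp (lineZ a φ * (u : ℂ)) *
      Complex.exp (lineZ a φ ^ 2 * (t : ℂ) / 2)

/-- Left inversions minus right inversions at `j` equals `j - σ j`. -/
lemma card_left_inversions_add (N : ℕ) (σ : Equiv.Perm (Fin N)) (j : Fin N) :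
    (Finset.univ.filter fun i => i < j ∧ σ j < σ i).card + (σ j : ℕ) =
      (Finset.univ.filter fun k => j < k ∧ σ k < σ j).card + (j : ℕ) := by
  have h₁ : (Finset.univ.filter fun i => i < j ∧ σ j < σ i).card +
      (Finset.univ.filter fun i => i < j ∧ σ i < σ j).card = j := by
    rw [← Finset.card_union_of_disjoint]
    · rw [← Fin.card_Iio j]
      congr 1
      ext i
      have : σ i = σ j ↔ i = j := σ.injective.eq_iff
      simp only [Finset.mem_union, Finset.mem_filter, Finset.mem_univ, Finset.mem_Iio]
      grind
    · rw [Finset.disjoint_filter]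
      grind
  have h₂ : (Finset.univ.filter fun k => j < k ∧ σ k < σ j).card +
      (Finset.univ.filter fun i => i < j ∧ σ i < σ j).card = σ j := by
    rw [← Finset.card_union_of_disjoint]
    · rw [← Fin.card_Iio (σ j), ← Finset.card_map (s := Finset.Iio (σ j)) σ.symm.toEmbedding]
      congr 1
      ext i
      simp only [Finset.mem_union, Finset.mem_filter, Finset.mem_univ, Finset.mem_map_equiv,
        Finset.mem_Iio, Equiv.symm_symm]
      grind
    · rw [Finset.disjoint_filter]
      grind
  omega

lemma prod_inversions_neg_div {K : Type*} [Field K] (N : ℕ) (σ : Equiv.Perm (Fin N))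
    (w : Fin N → K) (hw : ∀ j, w j ≠ 0) :
    ∏ pr ∈ Finset.univ.filter (fun pr : Fin N × Fin N => pr.1 < pr.2 ∧ σ pr.2 < σ pr.1),
        (-(w pr.2) / w pr.1) =
      ((Equiv.Perm.sign σ : ℤ) : K) *
        ∏ j, w j ^ (((j : ℕ) : ℤ) - ((σ j : ℕ) : ℤ)) := by
  have hsign : ∏ pr ∈ Finset.univ.filter
      (fun pr : Fin N × Fin N => pr.1 < pr.2 ∧ σ pr.2 < σ pr.1), (-1 : K) =
      ((Equiv.Perm.sign σ : ℤ) : K) := by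
    rw [Equiv.Perm.sign_eq_prod_prod_Iio, Finset.prod_filter, Fintype.prod_prod_type_right]
    push_cast
    refine Finset.prod_congr rfl fun j _ => ?_
    rw [← Finset.prod_filter, ← Finset.filter_filter]
    have : (Finset.univ.filter fun i : Fin N => i < j) = Finset.Iio j := by ext; simp
    rw [this, Finset.prod_filter]
    refine Finset.prod_congr rfl fun i hi => ?_
    have hne : σ i ≠ σ j := σ.injective.ne (Finset.mem_Iio.mp hi).ne
    rcases lt_or_gt_of_ne hne with h | h
    · simp [h, h.not_gt]
    · simp [h, h.not_gt]
  have hnum : ∏ pr ∈ Finset.univ.filter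
      (fun pr : Fin N × Fin N => pr.1 < pr.2 ∧ σ pr.2 < σ pr.1), w pr.2 =
      ∏ j, w j ^ (Finset.univ.filter fun i => i < j ∧ σ j < σ i).card := by
    rw [Finset.prod_filter, Fintype.prod_prod_type_right]
    refine Finset.prod_congr rfl fun j _ => ?_
    simp only [← Finset.prod_filter, Finset.prod_const]
  have hden : ∏ pr ∈ Finset.univ.filter
      (fun pr : Fin N × Fin N => pr.1 < pr.2 ∧ σ pr.2 < σ pr.1), w pr.1 =
      ∏ j, w j ^ (Finset.univ.filter fun k => j < k ∧ σ k < σ j).card := by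
    rw [Finset.prod_filter, Fintype.prod_prod_type]
    refine Finset.prod_congr rfl fun j _ => ?_
    simp only [← Finset.prod_filter, Finset.prod_const]
  simp_rw [neg_div, neg_eq_neg_one_mul (_ / _)]
  rw [Finset.prod_mul_distrib, Finset.prod_div_distrib, hsign, hnum, hden,
    ← Finset.prod_div_distrib]
  congr 1
  refine Finset.prod_congr rfl fun j _ => ?_
  rw [← zpow_natCast, ← zpow_natCast, ← zpow_sub₀ (hw j)]
  congr 1
  have := card_left_inversions_add N σ j
  omega

lemma lineZ_ne_zero {a : ℝ} (ha : 0 < a) (φ : ℝ) : lineZ a φ ≠ 0 := by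
  intro h
  have : (lineZ a φ).re = a := by simp [lineZ]
  rw [h, Complex.zero_re] at this
  exact ha.ne this

/-- The totally asymmetric (`τ = 0`, `q = 1`) Bethe-ansatz transition density is the
determinant `det(F_{i−j}(x_i − y_j))`: the amplitude factor for each inversion
`(α,β) ∈ In(σ)` is `−z_β/z_α`. -/
theorem bethe_tau_zero_eq_det (N : ℕ) (hN : 1 ≤ N) (a t : ℝ) (ha : 0 < a) (ht : 0 < t)
    (x y : Fin N → ℝ) :
    ∑ σ : Equiv.Perm (Fin N),
      ((1 / (2 * Real.pi)) ^ N : ℂ) *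
        ∫ φ : Fin N → ℝ,
          (∏ pr ∈ Finset.univ.filter
              (fun pr : Fin N × Fin N => pr.1 < pr.2 ∧ σ pr.2 < σ pr.1),
            (-(lineZ a (φ (σ pr.2))) / lineZ a (φ (σ pr.1)))) *
          ∏ j : Fin N,
            Complex.exp (lineZ a (φ (σ j)) * ((x j : ℂ) - (y (σ j) : ℂ))) *
              Complex.exp (lineZ a (φ j) ^ 2 * (t : ℂ) / 2)
    = Matrix.det (Matrix.of fun i j : Fin N =>
        Fm a t (((i : ℕ) : ℤ) - ((j : ℕ) : ℤ)) (x i - y j)) := by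
  rw [← Matrix.det_transpose, Matrix.det_apply']
  refine Finset.sum_congr rfl fun σ _ => ?_
  simp only [Matrix.transpose_apply, Matrix.of_apply, Fm]
  rw [Finset.prod_mul_distrib, Finset.prod_const, Finset.card_univ, Fintype.card_fin,
    mul_left_comm]
  congr 1
  have hint (φ : Fin N → ℝ) :
      (∏ pr ∈ Finset.univ.filter
          (fun pr : Fin N × Fin N => pr.1 < pr.2 ∧ σ pr.2 < σ pr.1),
        (-(lineZ a (φ (σ pr.2))) / lineZ a (φ (σ pr.1)))) *
      ∏ j : Fin N,
        Complex.exp (lineZ a (φ (σ j)) * ((x j : ℂ) - (y (σ j) : ℂ))) *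
          Complex.exp (lineZ a (φ j) ^ 2 * (t : ℂ) / 2) =
      ((Equiv.Perm.sign σ : ℤ) : ℂ) * ∏ k : Fin N,
        (lineZ a (φ k) ^ (((σ.symm k : ℕ) : ℤ) - ((k : ℕ) : ℤ)) *
          Complex.exp (lineZ a (φ k) * ((x (σ.symm k) - y k : ℝ) : ℂ)) *
          Complex.exp (lineZ a (φ k) ^ 2 * (t : ℂ) / 2)) := by
    rw [prod_inversions_neg_div N σ (fun j => lineZ a (φ (σ j)))
      (fun j => lineZ_ne_zero ha _), mul_assoc]
    congr 1
    rw [Finset.prod_mul_distrib,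
      ← Equiv.prod_comp σ (fun j => Complex.exp (lineZ a (φ j) ^ 2 * (t : ℂ) / 2)),
      ← Finset.prod_mul_distrib, ← Finset.prod_mul_distrib,
      ← Equiv.prod_comp σ (fun k : Fin N => (lineZ a (φ k) ^ _ * _ * _ : ℂ))]
    refine Finset.prod_congr rfl fun j _ => ?_
    simp [mul_assoc]
  simp_rw [hint]
  rw [integral_const_mul, integral_fintype_prod_volume_eq_prod (fun (k : Fin N) (s : ℝ) =>
    lineZ a s ^ (((σ.symm k : ℕ) : ℤ) - ((k : ℕ) : ℤ)) *
      Complex.exp (lineZ a s * ((x (σ.symm k) - y k : ℝ) : ℂ)) *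
      Complex.exp (lineZ a s ^ 2 * (t : ℂ) / 2))]
  rw [← Equiv.prod_comp σ]
  simp only [Equiv.symm_apply_apply]
end

section
/- Let a ∈ ℝ, b ∈ ℂ and u ∈ ℝ with u ≠ 0, and consider the improper contour integral J(u) := lim_{R→∞} (1/(2π)) ∫_{−R}^{R} e^{(a+iφ−b)u} / (a+iφ−b) dφ. (i) If Re(b) < a, then the limit exists and J(u) = 1 for u > 0 and J(u) = 0 for u < 0. (ii) If Re(b) > a, then the limit exists and J(u) = 0 for u > 0 and J(u) = −1 for u < 0. -/
open MeasureTheory Filter intervalIntegral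

theorem integrable_inv_sq_add_mul_I {c : ℂ} (hc : c.re ≠ 0) :
    Integrable (fun x : ℝ => ((c + x * Complex.I) ^ 2)⁻¹) := by
  have hne : ∀ x : ℝ, c + x * Complex.I ≠ 0 := fun x h => hc (by simpa using congrArg Complex.re h)
  have h := ((integrable_inv_one_add_sq.comp_div hc).comp_add_right c.im).const_mul (c.re ^ 2)⁻¹
  refine h.mono' (Continuous.aestronglyMeasurable ?_) (Eventually.of_forall fun x => le_of_eq ?_)
  · exact Continuous.inv₀ (by fun_prop) fun x => pow_ne_zero 2 (hne x)
  · rw [norm_inv, norm_pow, ← Complex.normSq_eq_norm_sq, Complex.normSq_apply, ← mul_inv]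
    congr 1
    simp
    field_simp
    ring

theorem integrable_max_mul_exp_neg_mul {c : ℂ} (hc : 0 < c.re) :
    Integrable (fun t : ℝ => ((max t 0 : ℝ) : ℂ) * Complex.exp (-(c * t))) := by
  have h : IntegrableOn (fun t : ℝ => t * Real.exp (-c.re * t)) (Set.Ioi 0) := by
    simpa using integrableOn_rpow_mul_exp_neg_mul_rpow (p := 1) (s := 1) (by norm_num) one_pos hc
  refine (h.integrable_indicator measurableSet_Ioi).mono' (by fun_prop)
    (Eventually.of_forall fun t => le_of_eq ?_)
  by_cases ht : 0 < t
  · simp [Set.indicator, ht, ht.le, Complex.norm_exp, abs_of_pos ht]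
  · simp [Set.indicator, ht, not_lt.mp ht]

theorem integral_max_mul_exp_neg_mul {c : ℂ} (hc : 0 < c.re) :
    ∫ t : ℝ, ((max t 0 : ℝ) : ℂ) * Complex.exp (-(c * t)) = (c ^ 2)⁻¹ := by
  have hc0 : c ≠ 0 := fun h => by simp [h] at hc
  have hset : ∫ t : ℝ, ((max t 0 : ℝ) : ℂ) * Complex.exp (-(c * t)) =
      ∫ t in Set.Ioi (0 : ℝ), ((max t 0 : ℝ) : ℂ) * Complex.exp (-(c * t)) := by
    refine (setIntegral_eq_integral_of_forall_compl_eq_zero fun t ht => ?_).symm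
    simp [max_eq_right (not_lt.mp (Set.mem_Ioi.not.mp ht))]
  have hlim : Tendsto (fun t : ℝ => -((t / c + (c ^ 2)⁻¹) * Complex.exp (-(c * t)))) atTop
      (nhds 0) := by
    have h0 : Tendsto (fun t : ℝ => Complex.exp (-(c * t))) atTop (nhds 0) := by
      rw [tendsto_zero_iff_norm_tendsto_zero]
      simpa [Complex.norm_exp] using tendsto_id.const_mul_atTop hc
    have h1 : Tendsto (fun t : ℝ => (t : ℂ) * Complex.exp (-(c * t))) atTop (nhds 0) := by
      rw [tendsto_zero_iff_norm_tendsto_zero]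
      have h := (tendsto_rpow_mul_exp_neg_mul_atTop_nhds_zero 1 c.re hc)
      refine h.congr' ?_
      filter_upwards [eventually_ge_atTop 0] with t ht
      simp [Complex.norm_exp, abs_of_nonneg ht]
    have h2 := ((h1.const_mul c⁻¹).add (h0.const_mul (c ^ 2)⁻¹)).neg
    simp only [mul_zero, add_zero, neg_zero] at h2
    exact h2.congr fun t => by ring
  rw [hset, integral_Ioi_of_hasDerivAt_of_tendsto' (m := 0)
    (f := fun t : ℝ => -((t / c + (c ^ 2)⁻¹) * Complex.exp (-(c * t)))) (fun t ht => ?_)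
    (integrable_max_mul_exp_neg_mul hc).integrableOn hlim]
  · simp
  · rw [max_eq_left ht]
    have hid : HasDerivAt (fun t : ℝ => (t : ℂ)) 1 t := Complex.ofRealCLM.hasDerivAt
    have hderiv : HasDerivAt (fun t : ℝ => Complex.exp (-(c * t)))
        (Complex.exp (-(c * t)) * -(c * 1)) t := (hid.const_mul c).neg.cexp
    refine (((hid.div_const c).add_const (c ^ 2)⁻¹).mul hderiv).neg.congr_deriv ?_
    field_simp
    ring

open FourierTransform in
theorem integral_exp_mul_I_mul_inv_sq {c : ℂ} (hc : 0 < c.re) (u : ℝ) :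
    ∫ x : ℝ, Complex.exp (x * Complex.I * u) * ((c + x * Complex.I) ^ 2)⁻¹ =
      2 * Real.pi * (((max u 0 : ℝ) : ℂ) * Complex.exp (-(c * u))) := by
  set g : ℝ → ℂ := fun t => ((max t 0 : ℝ) : ℂ) * Complex.exp (-(c * t)) with hg
  have hF : 𝓕 g = fun w : ℝ => ((c + (2 * Real.pi * w : ℝ) * Complex.I) ^ 2)⁻¹ := by
    funext w
    rw [Real.fourier_real_eq_integral_exp_smul,
      ← integral_max_mul_exp_neg_mul (c := c + (2 * Real.pi * w : ℝ) * Complex.I) (by simpa using hc)]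
    refine integral_congr_ae (Eventually.of_forall fun t => ?_)
    simp only [hg, smul_eq_mul]
    rw [mul_left_comm, ← Complex.exp_add]
    congr 2
    push_cast
    ring
  have hFi : Integrable (𝓕 g) := by
    rw [hF]
    exact (integrable_inv_sq_add_mul_I hc.ne').comp_mul_left' (R := 2 * Real.pi) (by positivity)
  have hinv := congrFun (Continuous.fourierInv_fourier_eq (f := g) (by fun_prop)
    (integrable_max_mul_exp_neg_mul hc) hFi) u
  rw [Real.fourierInv_eq', hF] at hinv
  have hsub := Measure.integral_comp_mul_left
    (fun x : ℝ => Complex.exp (x * Complex.I * u) * ((c + x * Complex.I) ^ 2)⁻¹) (2 * Real.pi)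
  have hpi : (Real.pi : ℂ) ≠ 0 := by exact_mod_cast Real.pi_ne_zero
  change _ = _ * g u
  rw [← hinv]
  have : ∫ v : ℝ, Complex.exp (↑(2 * Real.pi * inner ℝ v u) * Complex.I) •
      ((c + (2 * Real.pi * v : ℝ) * Complex.I) ^ 2)⁻¹ = _ := Eq.trans ?_ hsub
  · rw [this, abs_of_pos (by positivity), Complex.real_smul]
    push_cast
    rw [← mul_assoc, mul_inv_cancel₀ (by simp [hpi]), one_mul]
  · refine integral_congr_ae (Eventually.of_forall fun t => ?_)
    simp only [smul_eq_mul]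
    congr 2
    simp
    ring

theorem tendsto_integral_exp_div {c : ℂ} (hc : 0 < c.re) {u : ℝ} (hu : u ≠ 0) :
    Tendsto (fun R : ℝ => (1 / (2 * Real.pi) : ℂ) * ∫ x in (-R)..R,
      Complex.exp ((c + x * Complex.I) * u) / (c + x * Complex.I)) atTop
      (nhds (if 0 < u then 1 else 0)) := by
  have hne : ∀ x : ℝ, c + x * Complex.I ≠ 0 :=
    fun x h => hc.ne' (by simpa using congrArg Complex.re h)
  have hu' : (u : ℂ) ≠ 0 := by exact_mod_cast hu
  have hpi : (Real.pi : ℂ) ≠ 0 := by exact_mod_cast Real.pi_ne_zero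
  set G : ℝ → ℂ := fun x => Complex.exp (x * Complex.I * u) * ((c + x * Complex.I) ^ 2)⁻¹ with hG
  set F : ℝ → ℂ := fun x =>
    Complex.exp ((c + x * Complex.I) * u) / (Complex.I * u * (c + x * Complex.I)) with hFdef
  have hcont : Continuous fun x : ℝ =>
      Complex.exp ((c + x * Complex.I) * u) / (c + x * Complex.I) :=
    Continuous.div (by fun_prop) (by fun_prop) hne
  have hGc : Continuous G :=
    Continuous.mul (by fun_prop) (Continuous.inv₀ (by fun_prop) fun x => pow_ne_zero 2 (hne x))
  have hGi : Integrable G := by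
    refine (integrable_inv_sq_add_mul_I hc.ne').norm.mono' hGc.aestronglyMeasurable
      (Eventually.of_forall fun x => ?_)
    simp [hG, Complex.norm_exp]
  have hderiv : ∀ x : ℝ, HasDerivAt F
      (Complex.exp ((c + x * Complex.I) * u) / (c + x * Complex.I) -
        Complex.exp (c * u) / u * G x) x := fun x => by
    have hid : HasDerivAt (fun x : ℝ => c + (x : ℂ) * Complex.I) Complex.I x := by
      simpa using (Complex.ofRealCLM.hasDerivAt (x := x)).mul_const Complex.I |>.const_add c
    have hx := hne x
    refine ((hid.mul_const (u : ℂ)).cexp.div (hid.const_mul (Complex.I * u))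
      (mul_ne_zero (mul_ne_zero Complex.I_ne_zero hu') hx)).congr_deriv ?_
    rw [hG]
    rw [show (c + x * Complex.I) * u = c * u + x * Complex.I * u by ring, Complex.exp_add]
    have := Complex.I_ne_zero
    field_simp
  have hparts : ∀ R : ℝ, ∫ x in (-R)..R,
      Complex.exp ((c + x * Complex.I) * u) / (c + x * Complex.I) =
        F R - F (-R) + Complex.exp (c * u) / u * ∫ x in (-R)..R, G x := fun R => by
    have h := integral_eq_sub_of_hasDerivAt (fun x _ => hderiv x)
      ((hcont.sub (hGc.const_mul _)).intervalIntegrable (-R) R)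
    rw [integral_sub (hcont.intervalIntegrable _ _) ((hGc.const_mul _).intervalIntegrable _ _),
      intervalIntegral.integral_const_mul] at h
    rw [← h]
    ring
  have hFlim : Tendsto F (cocompact ℝ) (nhds 0) := by
    have hinf : Tendsto (fun x : ℝ => ‖c + x * Complex.I‖) (cocompact ℝ) atTop := by
      refine tendsto_atTop_mono (fun x => ?_) (tendsto_atTop_add_const_right _ (-‖c‖)
        (tendsto_norm_cocompact_atTop (E := ℝ)))
      have := norm_sub_norm_le ((x : ℂ) * Complex.I) (-c)
      simp only [norm_mul, Complex.norm_I, mul_one, Complex.norm_real, norm_neg, sub_neg_eq_add,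
        add_comm _ c] at this
      linarith
    rw [tendsto_zero_iff_norm_tendsto_zero]
    have h := hinf.inv_tendsto_atTop.const_mul (Real.exp (c.re * u) / |u|)
    rw [mul_zero] at h
    refine h.congr fun x => ?_
    simp [hFdef, Complex.norm_exp]
    ring
  have hF₁ := hFlim.comp (atTop_le_cocompact (α := ℝ))
  have hF₂ := (hFlim.comp (atBot_le_cocompact (α := ℝ))).comp tendsto_neg_atTop_atBot
  have hGlim := intervalIntegral_tendsto_integral hGi tendsto_neg_atTop_atBot tendsto_id
  rw [integral_exp_mul_I_mul_inv_sq hc] at hGlim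
  have h := ((hF₁.sub hF₂).add (hGlim.const_mul (Complex.exp (c * u) / u))).const_mul
    (1 / (2 * Real.pi) : ℂ)
  simp_rw [hparts]
  refine (congrArg (fun z => Tendsto _ _ (nhds z)) ?_).mp h
  rw [Complex.exp_neg]
  have := Complex.exp_ne_zero (c * u)
  split_ifs with h0
  · rw [max_eq_left h0.le]
    field_simp
    simp
  · simp [max_eq_right (not_lt.mp h0)]

/-- The improper contour integral `J(u) = (1/(2πi)) ∫_{Γ_a} e^{(z−b)u}/(z−b) dz`, understood
as the symmetric improper integral, equals `θ(u)` when `Re b < a` and `−θ(−u)` when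
`Re b > a`. -/
theorem heaviside_contour_integral (a : ℝ) (b : ℂ) (u : ℝ) (hu : u ≠ 0) :
    (b.re < a →
      ((0 < u → Filter.Tendsto (fun R : ℝ =>
          (1 / (2 * Real.pi) : ℂ) * ∫ φ in (-R)..R,
            Complex.exp (((a : ℂ) + φ * Complex.I - b) * u) /
              ((a : ℂ) + φ * Complex.I - b)) Filter.atTop (nhds 1)) ∧
       (u < 0 → Filter.Tendsto (fun R : ℝ =>
          (1 / (2 * Real.pi) : ℂ) * ∫ φ in (-R)..R,
            Complex.exp (((a : ℂ) + φ * Complex.I - b) * u) /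
              ((a : ℂ) + φ * Complex.I - b)) Filter.atTop (nhds 0)))) ∧
    (a < b.re →
      ((0 < u → Filter.Tendsto (fun R : ℝ =>
          (1 / (2 * Real.pi) : ℂ) * ∫ φ in (-R)..R,
            Complex.exp (((a : ℂ) + φ * Complex.I - b) * u) /
              ((a : ℂ) + φ * Complex.I - b)) Filter.atTop (nhds 0)) ∧
       (u < 0 → Filter.Tendsto (fun R : ℝ =>
          (1 / (2 * Real.pi) : ℂ) * ∫ φ in (-R)..R,
            Complex.exp (((a : ℂ) + φ * Complex.I - b) * u) /
              ((a : ℂ) + φ * Complex.I - b)) Filter.atTop (nhds (-1))))) := by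
  have hshift : ∀ φ : ℝ, (a : ℂ) + φ * Complex.I - b = (a - b) + φ * Complex.I := fun φ => by ring
  simp_rw [hshift]
  refine ⟨fun hb => ?_, fun hb => ?_⟩
  · have h := tendsto_integral_exp_div (c := a - b) (by simpa using hb) hu
    exact ⟨fun h0 => by simpa [h0] using h, fun h0 => by simpa [h0.not_gt] using h⟩
  · have h := (tendsto_integral_exp_div (c := b - a) (by simpa using hb) (neg_ne_zero.mpr hu)).neg
    have hreflect : ∀ R : ℝ, -((1 / (2 * Real.pi) : ℂ) * ∫ x in (-R)..R,
        Complex.exp ((b - a + x * Complex.I) * (-u : ℝ)) / (b - a + x * Complex.I)) =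
        (1 / (2 * Real.pi) : ℂ) * ∫ x in (-R)..R,
          Complex.exp ((a - b + x * Complex.I) * u) / (a - b + x * Complex.I) := fun R => by
      have hneg := integral_comp_neg (a := -R) (b := R) fun x : ℝ =>
        Complex.exp ((b - a + x * Complex.I) * (-u : ℝ)) / (b - a + x * Complex.I)
      rw [neg_neg] at hneg
      rw [← mul_neg, ← hneg, ← intervalIntegral.integral_neg]
      congr 1
      refine integral_congr fun x _ => ?_
      rw [← div_neg]
      congr 2 <;> push_cast <;> ring
    simp_rw [hreflect] at h
    exact ⟨fun h0 => by simpa [h0.not_gt, h0.le] using h, fun h0 => by simpa [h0] using h⟩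
end

section
/- Let m ≥ 1, a > 0, ε > 0, let f : ℝ → ℝ be smooth with compact support contained in [ε,∞), let a₁,…,a_m ∈ ℂ, and let b₁,…,b_m ∈ ℂ with Re(b_j) > a for every j. Define, for t > 0, I(t) = ∫_ε^∞ f(w) [ (1/(2π)) ∫_ℝ e^{(a+iφ)² t/2} e^{(a+iφ)w} ∏_{j=1}^m ((a+iφ) + a_j)/((a+iφ) − b_j) dφ ] dw. Then lim_{t→0+} I(t) = 0. -/
open MeasureTheory Filter Set

/-- `I(t) = ∫_ε^∞ f(w) [(1/(2πi)) ∫_{Γ_a} e^{z²t/2} e^{zw} ∏_j (z+a_j)/(z−b_j) dz] dw`. -/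
noncomputable def Ifun (m : ℕ) (a ε : ℝ) (f : ℝ → ℝ) (A B : Fin m → ℂ) (t : ℝ) : ℂ :=
  ∫ w in Set.Ioi ε, (f w : ℂ) *
    ((1 / (2 * Real.pi) : ℂ) * ∫ φ : ℝ,
      Complex.exp (((a : ℂ) + φ * Complex.I) ^ 2 * (t : ℂ) / 2) *
        Complex.exp (((a : ℂ) + φ * Complex.I) * (w : ℂ)) *
        ∏ j : Fin m, (((a : ℂ) + φ * Complex.I) + A j) / (((a : ℂ) + φ * Complex.I) - B j))

/-- Shifting a vertical contour: the integrals of a function that is holomorphic on a closed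
vertical strip and dominated there by an integrable function of the imaginary part that vanishes
at infinity agree on the two boundary lines. -/
theorem integral_vertical_eq_of_norm_le {F : ℂ → ℂ} {x₁ x₂ : ℝ} (hx : x₁ ≤ x₂) {g : ℝ → ℝ}
    (hF : ∀ z : ℂ, z.re ∈ Set.Icc x₁ x₂ → DifferentiableAt ℂ F z)
    (hg : Integrable g) (hg_top : Tendsto g atTop (nhds 0)) (hg_bot : Tendsto g atBot (nhds 0))
    (hFg : ∀ z : ℂ, z.re ∈ Set.Icc x₁ x₂ → ‖F z‖ ≤ g z.im) :
    ∫ y : ℝ, F (x₁ + y * Complex.I) = ∫ y : ℝ, F (x₂ + y * Complex.I) := by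
  have hint : ∀ x ∈ Set.Icc x₁ x₂, Integrable fun y : ℝ => F (x + y * Complex.I) := by
    intro x hx'
    refine hg.mono' (Continuous.aestronglyMeasurable ?_) (Eventually.of_forall fun y => ?_)
    · refine continuous_iff_continuousAt.2 fun y => ?_
      refine ContinuousAt.comp' (f := fun y : ℝ => (x + y * Complex.I : ℂ))
        (hF _ (by simpa using hx')).continuousAt ?_
      fun_prop
    · simpa using hFg (x + y * Complex.I) (by simpa using hx')
  have hlim : ∀ x ∈ Set.Icc x₁ x₂, Tendsto (fun T : ℝ => ∫ y in (-T)..T, F (x + y * Complex.I))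
      atTop (nhds (∫ y : ℝ, F (x + y * Complex.I))) := fun x hx' =>
    intervalIntegral_tendsto_integral (hint x hx') tendsto_neg_atTop_atBot tendsto_id
  have hhor : ∀ T : ℝ, ‖∫ x in x₁..x₂, F (x + T * Complex.I)‖ ≤ g T * |x₂ - x₁| := by
    intro T
    refine intervalIntegral.norm_integral_le_of_norm_le_const fun x hx' => ?_
    rw [uIoc_of_le hx] at hx'
    simpa using hFg (x + T * Complex.I) (by simpa using Ioc_subset_Icc_self hx')
  have hhor_top : Tendsto (fun T : ℝ => ∫ x in x₁..x₂, F (x + T * Complex.I)) atTop (nhds 0) :=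
    squeeze_zero_norm hhor (by simpa using hg_top.mul_const |x₂ - x₁|)
  have hhor_bot : Tendsto (fun T : ℝ => ∫ x in x₁..x₂, F (x + (-T : ℝ) * Complex.I)) atTop
      (nhds 0) :=
    squeeze_zero_norm (fun T => hhor (-T))
      (by simpa using (hg_bot.comp tendsto_neg_atTop_atBot).mul_const |x₂ - x₁|)
  have hrect : ∀ T : ℝ,
      (∫ x in x₁..x₂, F (x + (-T : ℝ) * Complex.I)) - (∫ x in x₁..x₂, F (x + T * Complex.I)) +
        Complex.I • (∫ y in (-T)..T, F (x₂ + y * Complex.I)) -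
        Complex.I • (∫ y in (-T)..T, F (x₁ + y * Complex.I)) = 0 := by
    intro T
    have h := Complex.integral_boundary_rect_eq_zero_of_differentiableOn F
      ⟨x₁, -T⟩ ⟨x₂, T⟩ (fun z hz => (hF z ?_).differentiableWithinAt)
    · simpa using h
    · have := hz.1
      simpa [uIcc_of_le hx] using this
  have h := (((hhor_bot.sub hhor_top).add
    ((hlim x₂ (right_mem_Icc.2 hx)).const_smul Complex.I)).sub
    ((hlim x₁ (left_mem_Icc.2 hx)).const_smul Complex.I))
  have h0 := tendsto_nhds_unique (h.congr hrect) tendsto_const_nhds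
  have h1 : Complex.I *
      ((∫ y : ℝ, F (x₂ + y * Complex.I)) - ∫ y : ℝ, F (x₁ + y * Complex.I)) = 0 := by
    simpa [mul_sub] using h0
  exact (sub_eq_zero.1 ((mul_eq_zero.1 h1).resolve_left Complex.I_ne_zero)).symm

theorem norm_add_div_sub_le {z A B : ℂ} {a : ℝ} (hz : z.re ≤ a) (hB : a < B.re) :
    ‖(z + A) / (z - B)‖ ≤ 1 + ‖A + B‖ / (B.re - a) := by
  have hd : 0 < B.re - a := sub_pos.2 hB
  have hle : B.re - a ≤ ‖z - B‖ := by
    have h := Complex.abs_re_le_norm (z - B)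
    rw [Complex.sub_re] at h
    linarith [neg_abs_le (z.re - B.re)]
  have hne : z - B ≠ 0 := norm_pos_iff.1 (hd.trans_le hle)
  have heq : (z + A) / (z - B) = 1 + (A + B) / (z - B) := by
    field_simp
    ring
  rw [heq]
  refine (norm_add_le _ _).trans ?_
  rw [norm_one, norm_div]
  gcongr

theorem norm_cexp_sq_mul_cexp (z : ℂ) (t w : ℝ) :
    ‖Complex.exp (z ^ 2 * (t : ℂ) / 2) * Complex.exp (z * (w : ℂ))‖ =
      Real.exp (z.re ^ 2 * t / 2 + z.re * w) * Real.exp (-(t / 2) * z.im ^ 2) := by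
  rw [norm_mul, Complex.norm_exp, Complex.norm_exp, ← Real.exp_add, ← Real.exp_add]
  congr 1
  simp [pow_two, Complex.mul_re]
  ring

theorem tendsto_exp_neg_mul_sq_atTop {c : ℝ} (hc : 0 < c) :
    Tendsto (fun y : ℝ => Real.exp (-c * y ^ 2)) atTop (nhds 0) := by
  simp only [neg_mul]
  exact Real.tendsto_exp_neg_atTop_nhds_zero.comp
    ((tendsto_pow_atTop two_ne_zero).const_mul_atTop hc)

/-- The kernel bound obtained by moving the contour from `Re z = a` to `Re z = -ε / t`. -/
theorem norm_integral_kernel_le {ι : Type*} [Fintype ι] {a ε t w : ℝ} (ha : 0 < a) (hε : 0 < ε)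
    (ht : 0 < t) (hw : ε < w) (A B : ι → ℂ) (hB : ∀ j, a < (B j).re) :
    ‖∫ φ : ℝ, Complex.exp (((a : ℂ) + φ * Complex.I) ^ 2 * (t : ℂ) / 2) *
        Complex.exp (((a : ℂ) + φ * Complex.I) * (w : ℂ)) *
        ∏ j, (((a : ℂ) + φ * Complex.I) + A j) / (((a : ℂ) + φ * Complex.I) - B j)‖ ≤
      (∏ j, (1 + ‖A j + B j‖ / ((B j).re - a))) *
        (Real.exp (-(ε ^ 2 / 2) * t⁻¹) * Real.sqrt (Real.pi / (t / 2))) := by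
  set M : ℝ := ∏ j, (1 + ‖A j + B j‖ / ((B j).re - a)) with hM
  have hM0 : 0 ≤ M := Finset.prod_nonneg fun j _ => by
    have := sub_pos.2 (hB j)
    positivity
  set F : ℂ → ℂ := fun z => Complex.exp (z ^ 2 * (t : ℂ) / 2) * Complex.exp (z * (w : ℂ)) *
    ∏ j, (z + A j) / (z - B j) with hFdef
  have hFle : ∀ z : ℂ, z.re ≤ a → ‖F z‖ ≤
      M * Real.exp (z.re ^ 2 * t / 2 + z.re * w) * Real.exp (-(t / 2) * z.im ^ 2) := by
    intro z hz
    have hprod : ‖∏ j, (z + A j) / (z - B j)‖ ≤ M := by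
      rw [norm_prod]
      exact Finset.prod_le_prod (fun _ _ => norm_nonneg _)
        fun j _ => norm_add_div_sub_le hz (hB j)
    rw [hFdef]
    simp only
    rw [norm_mul, norm_cexp_sq_mul_cexp, mul_comm, mul_assoc]
    gcongr
  have hR : 0 < ε / t := div_pos hε ht
  have ht2 : 0 < t / 2 := half_pos ht
  have hgauss := integrable_exp_neg_mul_sq ht2
  have hshift : ∫ y : ℝ, F ((-(ε / t) : ℝ) + y * Complex.I) = ∫ y : ℝ, F (a + y * Complex.I) := by
    set C : ℝ := M * Real.exp (((ε / t) ^ 2 + a ^ 2) * t / 2 + a * w) with hC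
    have htop := (tendsto_exp_neg_mul_sq_atTop ht2).const_mul C
    rw [mul_zero] at htop
    refine integral_vertical_eq_of_norm_le (g := fun y => C * Real.exp (-(t / 2) * y ^ 2))
      (by linarith) ?_ (hgauss.const_mul C) htop ?_ ?_
    · intro z hz
      have hne : ∀ j, z - B j ≠ 0 := fun j h => by
        have := congrArg Complex.re h
        simp only [Complex.sub_re, Complex.zero_re] at this
        linarith [hB j, hz.2]
      have hp : DifferentiableAt ℂ (fun z => ∏ j, (z + A j) / (z - B j)) z :=
        DifferentiableAt.fun_finsetProd fun j _ =>
          DifferentiableAt.div (by fun_prop) (by fun_prop) (hne j)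
      rw [hFdef]
      fun_prop
    · simpa [Function.comp_def] using htop.comp tendsto_neg_atBot_atTop
    · intro z hz
      refine (hFle z hz.2).trans ?_
      have hw0 : 0 < w := hε.trans hw
      have h1 : z.re ^ 2 ≤ (ε / t) ^ 2 + a ^ 2 := by
        rcases le_total 0 z.re with h | h
        · nlinarith [hz.2]
        · nlinarith [hz.1]
      have h2 : z.re ≤ a := hz.2
      rw [hC]
      gcongr
  change ‖∫ y : ℝ, F (a + y * Complex.I)‖ ≤ _
  rw [← hshift, ← integral_gaussian, ← mul_assoc, ← integral_const_mul]
  refine norm_integral_le_of_norm_le (hgauss.const_mul _) (Eventually.of_forall fun y => ?_)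
  refine (hFle _ (by simp; linarith)).trans ?_
  have hexp : (-(ε / t)) ^ 2 * t / 2 + -(ε / t) * w ≤ -(ε ^ 2 / 2) * t⁻¹ := by
    have h1 : (-(ε / t)) ^ 2 * t / 2 = ε ^ 2 / 2 * t⁻¹ := by
      field_simp
    have h2 : ε / t * ε = ε ^ 2 * t⁻¹ := by
      field_simp
    nlinarith [mul_lt_mul_of_pos_left hw hR]
  simp only [Complex.add_re, Complex.ofReal_re, Complex.mul_re, Complex.I_re, mul_zero,
    Complex.ofReal_im, Complex.I_im, mul_one, sub_self, add_zero, Complex.add_im, Complex.mul_im,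
    zero_add]
  gcongr

theorem tendsto_exp_neg_mul_inv_mul_sqrt {k c : ℝ} (hk : 0 < k) :
    Tendsto (fun t : ℝ => Real.exp (-k * t⁻¹) * Real.sqrt (c / (t / 2)))
      (nhdsWithin 0 (Set.Ioi 0)) (nhds 0) := by
  have h := ((tendsto_rpow_mul_exp_neg_mul_atTop_nhds_zero (1 / 2) k hk).comp
    tendsto_inv_nhdsGT_zero).mul_const (Real.sqrt (c * 2))
  rw [zero_mul] at h
  refine h.congr' (eventually_nhdsWithin_of_forall fun t ht => ?_)
  have ht' : 0 ≤ t⁻¹ := inv_nonneg.2 (le_of_lt ht)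
  have : c / (t / 2) = t⁻¹ * (c * 2) := by
    field_simp
  simp only [Function.comp_apply]
  rw [this, Real.sqrt_mul ht', Real.sqrt_eq_rpow t⁻¹]
  ring

/-- `lim_{t→0+} I(t) = 0` when all poles `b_j` lie to the right of the contour and the
test function `f` is supported in `[ε, ∞)`. -/
theorem Ifun_tendsto_zero (m : ℕ) (hm : 1 ≤ m) (a ε : ℝ) (ha : 0 < a) (hε : 0 < ε)
    (f : ℝ → ℝ) (hf : ContDiff ℝ (⊤ : ℕ∞) f) (hfc : HasCompactSupport f)
    (hsupp : tsupport f ⊆ Set.Ici ε)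
    (A B : Fin m → ℂ) (hB : ∀ j, a < (B j).re) :
    Filter.Tendsto (fun t : ℝ => Ifun m a ε f A B t)
      (nhdsWithin 0 (Set.Ioi 0)) (nhds 0) := by
  have hfint : Integrable (fun w => ‖f w‖) (volume.restrict (Set.Ioi ε)) :=
    (hf.continuous.integrable_of_hasCompactSupport hfc).norm.restrict
  set M : ℝ := ∏ j, (1 + ‖A j + B j‖ / ((B j).re - a))
  set c : ℝ → ℝ := fun t =>
    1 / (2 * Real.pi) * (M * (Real.exp (-(ε ^ 2 / 2) * t⁻¹) * Real.sqrt (Real.pi / (t / 2))))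
  have hc : Tendsto (fun t => (∫ w in Set.Ioi ε, ‖f w‖) * c t) (nhdsWithin 0 (Set.Ioi 0))
      (nhds 0) := by
    have hk : 0 < ε ^ 2 / 2 := by positivity
    have h := (((tendsto_exp_neg_mul_inv_mul_sqrt (c := Real.pi) hk).const_mul M).const_mul
      (1 / (2 * Real.pi))).const_mul (∫ w in Set.Ioi ε, ‖f w‖)
    simpa only [mul_zero] using h
  refine squeeze_zero_norm' (eventually_nhdsWithin_of_forall fun t ht => ?_) hc
  rw [← integral_mul_const]
  refine norm_integral_le_of_norm_le (hfint.mul_const _)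
    ((ae_restrict_iff' measurableSet_Ioi).2 (Eventually.of_forall fun w hw => ?_))
  rw [norm_mul, Complex.norm_real, norm_mul]
  have hpi : ‖(1 / (2 * Real.pi) : ℂ)‖ = 1 / (2 * Real.pi) := by
    simp [abs_of_pos Real.pi_pos]
  rw [hpi]
  exact mul_le_mul_of_nonneg_left (mul_le_mul_of_nonneg_left
    (norm_integral_kernel_le ha hε ht hw A B hB) (by positivity)) (norm_nonneg _)
end

section
/- Let n ≥ 1 and let p ∈ (0,1) with p ≠ 1/2, q = 1−p, τ = p/q. Let A be the n×n real tridiagonal Toeplitz matrix with A_{ii} = 1, A_{i,i−1} = −q (i.e. entry −q when the row index exceeds the column index by 1), A_{i,i+1} = −p, and all other entries 0. Let k₁ = 1 and k₂ = q/p (the two distinct real roots of p k² − k + q = 0), and for 1 ≤ i ≤ j ≤ n set P_{ij} = (k₁^i − k₂^i)(k₁^{n+1−j} − k₂^{n+1−j}) / ( p (k₁ − k₂)(k₁^{n+1} − k₂^{n+1}) ). Then A is invertible and (A^{−1})_{ij} = P_{ij} for i ≤ j, while (A^{−1})_{ij} = τ^{j−i} P_{ji} for i ≥ j (where τ^{j−i}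 = (q/p)^{i−j} is an integer power of τ). -/
/-- The tridiagonal Toeplitz matrix with `1` on the diagonal, `−q` below and `−p` above. -/
noncomputable def toepA (n : ℕ) (p q : ℝ) : Matrix (Fin n) (Fin n) ℝ :=
  Matrix.of fun i j =>
    if (i : ℕ) = (j : ℕ) then 1
    else if (i : ℕ) = (j : ℕ) + 1 then -q
    else if (j : ℕ) = (i : ℕ) + 1 then -p
    else 0

/-- `P_{ij}` (in 1-based labelling; here `i j : Fin n` are 0-based, so the 1-based indices
are `i+1 ≤ j+1` and `n+1−(j+1) = n−j`), with `k₁ = 1`, `k₂ = q/p`. -/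
noncomputable def toepP (n : ℕ) (p q : ℝ) (i j : Fin n) : ℝ :=
  ((1 : ℝ) ^ ((i : ℕ) + 1) - (q / p) ^ ((i : ℕ) + 1)) *
    ((1 : ℝ) ^ (n - (j : ℕ)) - (q / p) ^ (n - (j : ℕ))) /
    (p * (1 - q / p) * ((1 : ℝ) ^ (n + 1) - (q / p) ^ (n + 1)))

/-- A row of `toepA` applied to a sequence vanishing at both ends is a three-term recurrence. -/
theorem toepA_mulVec_apply (n : ℕ) (p q : ℝ) (f : ℕ → ℝ) (h0 : f 0 = 0) (hn : f (n + 1) = 0)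
    (i : Fin n) :
    ∑ l : Fin n, toepA n p q i l * f (l + 1) = f (i + 1) - q * f i - p * f (i + 2) := by
  obtain ⟨i, hi⟩ := i
  have hsplit : ∀ l : Fin n, toepA n p q ⟨i, hi⟩ l * f (l + 1) =
      (if i = (l : ℕ) then f (i + 1) else 0) + (if i = (l : ℕ) + 1 then -q * f i else 0) +
        (if (l : ℕ) = i + 1 then -p * f (i + 2) else 0) := by
    intro l
    simp only [toepA, Matrix.of_apply]
    split_ifs <;> first | omega | simp_all
  have hlower : ∑ l ∈ Finset.range n, (if i = l + 1 then -q * f i else 0) = -q * f i := by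
    rcases i with _ | i
    · simp [h0]
    · simp only [Nat.add_right_cancel_iff, Finset.sum_ite_eq, Finset.mem_range]
      rw [if_pos (by omega)]
  have hupper : ∑ l ∈ Finset.range n, (if l = i + 1 then -p * f (i + 2) else 0) =
      -p * f (i + 2) := by
    rw [Finset.sum_ite_eq']
    split_ifs with h
    · rfl
    · rw [Finset.mem_range] at h
      rw [show i + 2 = n + 1 by omega, hn, mul_zero]
  simp only [hsplit]
  rw [Finset.sum_add_distrib, Finset.sum_add_distrib,
    ← Finset.sum_range fun l => if i = l then f (i + 1) else 0,
    ← Finset.sum_range fun l => if i = l + 1 then -q * f i else 0,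
    ← Finset.sum_range fun l => if l = i + 1 then -p * f (i + 2) else 0,
    hlower, hupper, Finset.sum_ite_eq, if_pos (Finset.mem_range.2 hi)]
  ring

/-- The Green function of the recurrence `p x (m + 1) - x m + q x (m - 1)` with `k = q / p` and
zero boundary values at `0` and `n + 1`. -/
noncomputable def toepGreen (n : ℕ) (p k : ℝ) (i j : ℕ) : ℝ :=
  (1 - k ^ min i j) * (k ^ max i j - k ^ (n + 1)) / (k ^ j * (p * (1 - k) * (1 - k ^ (n + 1))))

theorem toepGreen_recurrence (n : ℕ) (p k : ℝ) (hp : p ≠ 0) (hk : k ≠ 0) (hk1 : 1 - k ≠ 0)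
    (hkn : 1 - k ^ (n + 1) ≠ 0) (hpk : p * (1 + k) = 1) (i j : ℕ) :
    toepGreen n p k (i + 1) (j + 1) - p * k * toepGreen n p k i (j + 1) -
      p * toepGreen n p k (i + 2) (j + 1) = if i = j then 1 else 0 := by
  have hone : toepGreen n p k (i + 1) (j + 1) =
      p * (1 + k) * toepGreen n p k (i + 1) (j + 1) := by rw [hpk, one_mul]
  rw [hone]
  unfold toepGreen
  have hkj : k ^ j ≠ 0 := pow_ne_zero _ hk
  rcases lt_trichotomy i j with h | rfl | h
  · rw [if_neg h.ne, min_eq_left (by omega), max_eq_right (by omega), min_eq_left (by omega),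
      max_eq_right (by omega), min_eq_left (by omega), max_eq_right (by omega)]
    ring
  · rw [if_pos rfl, min_self, max_self, min_eq_left (by omega), max_eq_right (by omega),
      min_eq_right (by omega), max_eq_left (by omega)]
    field_simp
    ring
  · rw [if_neg h.ne', min_eq_right (by omega), max_eq_left (by omega), min_eq_right (by omega),
      max_eq_left (by omega), min_eq_right (by omega), max_eq_left (by omega)]
    ring

theorem toepGreen_eq_toepP (n : ℕ) (p q : ℝ) (hp : p ≠ 0) (hq : q ≠ 0) (i j : Fin n)
    (h : i ≤ j) : toepGreen n p (q / p) (i + 1) (j + 1) = toepP n p q i j := by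
  have hk : q / p ≠ 0 := div_ne_zero hq hp
  have h' : (i : ℕ) ≤ j := h
  unfold toepGreen toepP
  rw [min_eq_left (by omega), max_eq_right (by omega),
    show n + 1 = (j + 1) + (n - j) by omega, pow_add (q / p) (j + 1) (n - j)]
  generalize q / p = k at hk
  simp only [one_pow]
  rw [← mul_one_sub, mul_left_comm, mul_div_mul_left _ _ (pow_ne_zero ((j : ℕ) + 1) hk)]

/-- Exchanging the arguments of the Green function multiplies it by a power of `k`. -/
theorem toepGreen_swap (n : ℕ) (p k : ℝ) (hk : k ≠ 0) (i j : ℕ) :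
    toepGreen n p k i j = k ^ ((i : ℤ) - (j : ℤ)) * toepGreen n p k j i := by
  unfold toepGreen
  rw [min_comm, max_comm, zpow_sub₀ hk, zpow_natCast, zpow_natCast, div_mul_div_comm,
    mul_left_comm (k ^ j) (k ^ i), mul_div_mul_left _ _ (pow_ne_zero i hk)]

/-- Explicit inverse of the tridiagonal Toeplitz matrix `A`:
`(A⁻¹)_{ij} = P_{ij}` for `i ≤ j` and `(A⁻¹)_{ij} = τ^{j−i} P_{ji}` for `i ≥ j`,
where `τ = p/q`. -/
theorem toepA_inverse (n : ℕ) (hn : 1 ≤ n) (p : ℝ) (hp : p ∈ Set.Ioo (0 : ℝ) 1)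
    (hp2 : p ≠ 1 / 2) (q : ℝ) (hq : q = 1 - p) :
    IsUnit (toepA n p q) ∧
    ∀ i j : Fin n,
      (i ≤ j → (toepA n p q)⁻¹ i j = toepP n p q i j) ∧
      (j ≤ i → (toepA n p q)⁻¹ i j =
        (p / q) ^ (((j : ℕ) : ℤ) - ((i : ℕ) : ℤ)) * toepP n p q j i) := by
  obtain ⟨hp0, hp1⟩ := hp
  have hq0 : 0 < q := by linarith
  have hk : 0 < q / p := div_pos hq0 hp0
  have hk1 : q / p ≠ 1 := by
    rw [Ne, div_eq_one_iff_eq hp0.ne']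
    intro h
    apply hp2
    linarith
  have hkn : (q / p) ^ (n + 1) ≠ 1 := by
    rwa [Ne, pow_eq_one_iff_of_nonneg hk.le (Nat.succ_ne_zero n)]
  have hpk : p * (q / p) = q := mul_div_cancel₀ q hp0.ne'
  have hmul : toepA n p q *
      Matrix.of (fun i j : Fin n => toepGreen n p (q / p) (i + 1) (j + 1)) = 1 := by
    ext i j
    rw [Matrix.mul_apply, Matrix.one_apply]
    simp only [Matrix.of_apply]
    rw [toepA_mulVec_apply n p q (fun m => toepGreen n p (q / p) m (j + 1))
      (by simp [toepGreen]) (by simp [toepGreen])]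
    have hrec := toepGreen_recurrence n p (q / p) hp0.ne' hk.ne' (sub_ne_zero.2 hk1.symm)
      (sub_ne_zero.2 hkn.symm) (by rw [mul_add, hpk]; linarith) i j
    rw [hpk] at hrec
    simpa only [Fin.ext_iff] using hrec
  refine ⟨IsUnit.of_mul_eq_one _ hmul, fun i j => ?_⟩
  rw [Matrix.inv_eq_right_inv hmul, Matrix.of_apply]
  refine ⟨toepGreen_eq_toepP n p q hp0.ne' hq0.ne' i j, fun h => ?_⟩
  rw [toepGreen_swap n p _ hk.ne', toepGreen_eq_toepP n p q hp0.ne' hq0.ne' j i h,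
    ← inv_div q p, inv_zpow', neg_sub]
  push_cast
  rw [add_sub_add_right_eq_sub]
end

section
/- Let n ≥ 1 and let p ∈ (0,1/2), q = 1−p, τ = p/q. Let A be the n×n real tridiagonal Toeplitz matrix with A_{ii} = 1, A_{i,i−1} = −q, A_{i,i+1} = −p, and all other entries 0. Then A is invertible and the matrix C := D A^{−1}, where D = diag(1, τ, τ², …, τ^{n−1}), is symmetric and positive definite; in particular C satisfies C = Cᵀ, C > 0, and C A = diag(1, τ, …, τ^{n−1}). -/
/-- Summation by parts for the quadratic form of a geometrically weighted path. -/
theorem sum_weighted_path_eq (p q r : ℝ) (hpr : p * r = q) (hpq : p + q = 1) (y : ℕ → ℝ) (m : ℕ) :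
    ∑ i ∈ Finset.range (m + 1), y i * (r ^ i * y i
      - (if i = 0 then 0 else q * (r ^ (i - 1) * y (i - 1))) - p * (r ^ (i + 1) * y (i + 1))) =
    p * y 0 ^ 2 + q * ∑ i ∈ Finset.range (m + 1), r ^ i * (y i - y (i + 1)) ^ 2
      + q * r ^ m * (y m * y (m + 1) - y (m + 1) ^ 2) := by
  subst hpr
  induction m with
  | zero =>
    simp
    linear_combination (-y 0 ^ 2) * hpq
  | succ m ih =>
    rw [Finset.sum_range_succ, ih, Finset.sum_range_succ _ (m + 1)]
    simp only [Nat.add_eq_zero_iff, one_ne_zero, and_false, if_false, Nat.add_sub_cancel]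
    linear_combination (-(r ^ (m + 1) * y (m + 1) ^ 2)) * hpq

/-- The weighted path form is positive on nonzero sequences vanishing at the right endpoint. -/
theorem sum_weighted_path_pos (p q r : ℝ) (hp : 0 < p) (hr : 0 < r) (hpr : p * r = q)
    (hpq : p + q = 1) (y : ℕ → ℝ) (n : ℕ) (hyn : y n = 0) (hy : ∃ k < n, y k ≠ 0) :
    0 < ∑ i ∈ Finset.range n, y i * (r ^ i * y i
      - (if i = 0 then 0 else q * (r ^ (i - 1) * y (i - 1))) - p * (r ^ (i + 1) * y (i + 1))) := by
  obtain ⟨k, hk, hyk⟩ := hy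
  obtain ⟨m, rfl⟩ : ∃ m, n = m + 1 := ⟨n - 1, by omega⟩
  have hq : 0 < q := hpr ▸ mul_pos hp hr
  rw [sum_weighted_path_eq p q r hpr hpq, hyn]
  have hnn : ∀ i ∈ Finset.range (m + 1), 0 ≤ r ^ i * (y i - y (i + 1)) ^ 2 :=
    fun i _ => by positivity
  have hsum : 0 < ∑ i ∈ Finset.range (m + 1), r ^ i * (y i - y (i + 1)) ^ 2 := by
    refine (Finset.sum_nonneg hnn).lt_of_ne' fun h0 => hyk ?_
    rw [Finset.sum_eq_zero_iff_of_nonneg hnn] at h0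
    have hstep : ∀ i < m + 1, y i = y (i + 1) := fun i hi => by
      have := h0 i (Finset.mem_range.2 hi)
      have h2 := (mul_eq_zero.1 this).resolve_left (by positivity)
      exact sub_eq_zero.1 (pow_eq_zero_iff (two_ne_zero) |>.1 h2)
    refine Nat.decreasingInduction' (P := fun i => y i = 0) (fun i hi _ h => ?_) hk.le hyn
    rw [hstep i hi, h]
  have : 0 < q * ∑ i ∈ Finset.range (m + 1), r ^ i * (y i - y (i + 1)) ^ 2 := mul_pos hq hsum
  nlinarith [mul_nonneg hp.le (sq_nonneg (y 0))]

/-- A row of `toepA` applied to the restriction of a sequence vanishing at `n`. -/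
theorem toepA_mulVec_apply_s17 (n : ℕ) (p q : ℝ) (v : ℕ → ℝ) (hv : v n = 0) (i : Fin n) :
    (toepA n p q).mulVec (fun j => v j) i =
      v i - (if (i : ℕ) = 0 then 0 else q * v (i - 1)) - p * v (i + 1) := by
  obtain ⟨i, hi⟩ := i
  have h : ∀ j : ℕ, (if i = j then 1 else if i = j + 1 then -q else if j = i + 1 then -p else 0)
      * v j = (if j = i then v j else 0) - (if j = i - 1 then if i = 0 then 0 else q * v j else 0)
        - (if j = i + 1 then p * v j else 0) := by
    intro j
    split_ifs <;> first | omega | simp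
  simp only [Matrix.mulVec, dotProduct, toepA, Matrix.of_apply]
  rw [Fin.sum_univ_eq_sum_range (fun j => (if i = j then 1 else if i = j + 1 then -q
    else if j = i + 1 then -p else 0) * v j) n]
  simp only [h, Finset.sum_sub_distrib, Finset.sum_ite_eq', Finset.mem_range]
  rw [if_pos hi, if_pos (by omega : i - 1 < n)]
  congr 1
  split_ifs with h1
  · rfl
  · rw [show i + 1 = n by omega, hv, mul_zero]

/-- Rescaling the columns of `toepA` by powers of `q / p` gives a positive definite matrix. -/
theorem toepA_mul_diagonal_posDef (n : ℕ) (p q : ℝ) (hp : 0 < p) (hq : 0 < q) (hpq : p + q = 1) :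
    (toepA n p q * Matrix.diagonal fun i : Fin n => (q / p) ^ (i : ℕ)).PosDef := by
  have hpr : p * (q / p) = q := by field_simp
  have hr : 0 < q / p := div_pos hq hp
  generalize q / p = r at hpr hr
  refine Matrix.PosDef.of_dotProduct_mulVec_pos ?_ fun x hx => ?_
  · ext i j
    simp only [Matrix.conjTranspose_apply, Matrix.mul_diagonal, toepA, Matrix.of_apply, star_trivial]
    split_ifs with h1 h2 h3 h4 h5 h6 h7 <;> first | omega | skip
    all_goals simp_all [pow_succ]
    all_goals subst hpr; ring
  · set y : ℕ → ℝ := fun k => if h : k < n then x ⟨k, h⟩ else 0 with hydef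
    have hyn : y n = 0 := by simp [hydef]
    have hyx : ∀ i : Fin n, x i = y i := fun i => by simp [hydef]
    have hpos := sum_weighted_path_pos p q r hp hr hpr hpq y n hyn (by
      obtain ⟨i, hi⟩ := Function.ne_iff.1 hx
      exact ⟨i, i.2, by rw [← hyx]; exact hi⟩)
    have hdx : (Matrix.diagonal fun i : Fin n => r ^ (i : ℕ)).mulVec x =
        fun j : Fin n => r ^ (j : ℕ) * y j := by
      ext j
      rw [Matrix.mulVec_diagonal, hyx]
    rw [← Matrix.mulVec_mulVec, hdx, dotProduct]
    simp only [toepA_mulVec_apply_s17 n p q (fun j => r ^ j * y j) (by simp [hyn]), Pi.star_apply,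
      star_trivial, hyx]
    rwa [← Fin.sum_univ_eq_sum_range] at hpos

/-- There is a symmetric positive definite matrix `C` with `C A = diag(1, τ, …, τ^{n−1})`:
namely `C = D A⁻¹` with `D = diag(1, τ, …, τ^{n−1})`, `τ = p/q`. -/
theorem toepA_symmetrizer (n : ℕ) (hn : 1 ≤ n) (p : ℝ) (hp : p ∈ Set.Ioo (0 : ℝ) (1 / 2))
    (q : ℝ) (hq : q = 1 - p) :
    IsUnit (toepA n p q) ∧
    ((Matrix.diagonal fun i : Fin n => (p / q) ^ (i : ℕ)) * (toepA n p q)⁻¹).IsSymm ∧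
    ((Matrix.diagonal fun i : Fin n => (p / q) ^ (i : ℕ)) * (toepA n p q)⁻¹).PosDef ∧
    ((Matrix.diagonal fun i : Fin n => (p / q) ^ (i : ℕ)) * (toepA n p q)⁻¹) * toepA n p q =
      Matrix.diagonal fun i : Fin n => (p / q) ^ (i : ℕ) := by
  obtain ⟨hp0, hp1⟩ := hp
  have hq0 : 0 < q := by linarith
  have hS := toepA_mul_diagonal_posDef n p q hp0 hq0 (by linarith)
  set D := Matrix.diagonal fun i : Fin n => (p / q) ^ (i : ℕ) with hD
  set E := Matrix.diagonal fun i : Fin n => (q / p) ^ (i : ℕ) with hE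
  have hDE : D * E = 1 := by
    rw [hD, hE, Matrix.diagonal_mul_diagonal, ← Matrix.diagonal_one]
    congr 1
    ext i
    rw [← mul_pow, show p / q * (q / p) = 1 by field_simp, one_pow]
  have hA : IsUnit (toepA n p q) := isUnit_of_mul_isUnit_left hS.isUnit
  have hC : D * (toepA n p q)⁻¹ = (toepA n p q * E)⁻¹ := by
    rw [Matrix.mul_inv_rev, Matrix.inv_eq_left_inv hDE]
  have hCpos : (D * (toepA n p q)⁻¹).PosDef := hC ▸ hS.inv
  refine ⟨hA, ?_, hCpos, ?_⟩
  · have := hCpos.isHermitian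
    rwa [Matrix.IsHermitian, Matrix.conjTranspose_eq_transpose_of_trivial] at this
  · rw [Matrix.mul_assoc, Matrix.nonsing_inv_mul _ ((Matrix.isUnit_iff_isUnit_det _).1 hA),
      Matrix.mul_one]
end
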